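/- arXiv:2604.24737 — 8 statements merged into one kernel-verified Lean document; each statement's English description precedes it below -/
import Mathlib

section
/- For every n ≥ 1 and s ≥ 2, set d = n(2s−1)+4s−3 and T = 2s−1. There exists a map φ : {0,1}^n → {0,1}^d (depending only on n and s) such that for every depth-2 linear threshold circuit C of size s over {0,1}^n there exists a weight vector w ∈ ℝ^d with ete_{f_w}^T(φ(x)) = C(x) for all x ∈ {0,1}^n. -/
open scoped Classical

namespace CoTPaper

/-- Apply-and-append step of a next-token generator. -/
def appendStep (f : List Bool → Bool) (z : List Bool) : List Bool := z ++ [f z]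

/-- End-to-end function after `T` autoregressive steps: the last bit of the `T`-fold
apply-and-append composition applied to `x`. -/
def eteFn (f : List Bool → Bool) (T : ℕ) (x : List Bool) : Bool :=
  ((appendStep f)^[T] x).getLastD false

/-- Window-`d` autoregressive linear threshold generator:
`f_w(z) = 1[∑_{i=1}^{min(d,|z|)} w[−i]·z[−i] ≥ 0]`, where `z[−i]` is the `i`-th bit of `z`
from the end and `w[−i]` the `i`-th coordinate of `w` from the end. -/
noncomputable def linThr {d : ℕ} (w : Fin d → ℝ) (z : List Bool) : Bool :=
  decide (0 ≤ ∑ i : Fin (min d z.length),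
    w ((Fin.castLE (min_le_left d z.length) i).rev) *
      (if z.getD (z.length - 1 - (i : ℕ)) false then (1 : ℝ) else 0))

/-- A depth-2 linear threshold circuit of size `s` over `{0,1}^n`: `s − 1` hidden threshold
gates (weights `hw`, biases `hb`) and one output threshold gate (weights `ow`, bias `ob`). -/
structure Depth2Circuit (n s : ℕ) where
  hw : Fin (s - 1) → Fin n → ℝ
  hb : Fin (s - 1) → ℝ
  ow : Fin (s - 1) → ℝ
  ob : ℝ

/-- Value of the `i`-th hidden gate: `C_i(x) = 1[θ_i + ⟨w_i, x⟩ ≥ 0]`. -/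
noncomputable def Depth2Circuit.gate {n s : ℕ} (C : Depth2Circuit n s)
    (i : Fin (s - 1)) (x : Fin n → Bool) : Bool :=
  decide (0 ≤ C.hb i + ∑ j, C.hw i j * (if x j then (1 : ℝ) else 0))

/-- Output of the circuit: `C(x) = 1[θ_s + ∑_i w_s[i]·C_i(x) ≥ 0]`. -/
noncomputable def Depth2Circuit.out {n s : ℕ} (C : Depth2Circuit n s)
    (x : Fin n → Bool) : Bool :=
  decide (0 ≤ C.ob + ∑ i, C.ow i * (if C.gate i x then (1 : ℝ) else 0))

/-- The stream of bits produced by autoregressive generation from `x`: the bits of `x`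
followed by the successive outputs of `f`. -/
def stream (f : List Bool → Bool) (x : List Bool) (p : ℕ) : Bool :=
  if p < x.length then x.getD p false else f ((appendStep f)^[p - x.length] x)

theorem length_iterate_appendStep (f : List Bool → Bool) (x : List Bool) (t : ℕ) :
    ((appendStep f)^[t] x).length = x.length + t := by
  induction t with
  | zero => simp
  | succ t ih =>
    rw [Function.iterate_succ_apply', appendStep, List.length_append, ih]
    simp [add_assoc]

theorem getD_iterate_appendStep (f : List Bool → Bool) (x : List Bool) (t p : ℕ)
    (hp : p < x.length + t) :
    ((appendStep f)^[t] x).getD p false = stream f x p := by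
  induction t with
  | zero => simp only [add_zero] at hp; simp [stream, hp]
  | succ t ih =>
    have hlen := length_iterate_appendStep f x t
    rw [Function.iterate_succ_apply', appendStep]
    by_cases h : p < x.length + t
    · rw [List.getD_append _ _ _ _ (by omega), ih h]
    · obtain rfl : p = x.length + t := by omega
      rw [List.getD_append_right _ _ _ _ (by omega), hlen]
      simp [stream]

theorem eteFn_succ (f : List Bool → Bool) (T : ℕ) (x : List Bool) :
    eteFn f (T + 1) x = stream f x (x.length + T) := by
  simp [eteFn, Function.iterate_succ_apply', appendStep, stream]

/-- Real value of a bit. -/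
def bit (b : Bool) : ℝ := if b then 1 else 0

theorem linThr_eq_of_length {d t : ℕ} (w : ℕ → ℝ) (z : List Bool) (hz : z.length = d + t) :
    linThr (fun k : Fin d => w k) z =
      decide (0 ≤ ∑ k ∈ Finset.range d, w k * bit (z.getD (t + k) false)) := by
  have hmin : min d z.length = d := by omega
  rw [linThr, Finset.sum_range, ← Equiv.sum_comp (Fin.revPerm.trans (finCongr hmin.symm))]
  congr 2
  refine Finset.sum_congr rfl fun k _ => ?_
  have hk := k.isLt
  simp only [bit, Equiv.trans_apply, Fin.revPerm_apply, finCongr_apply, Fin.val_rev, Fin.val_cast,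
    Fin.val_castLE]
  have h1 : d - (d - (k + 1) + 1) = (k : ℕ) := by omega
  have h2 : z.length - 1 - (d - (k + 1)) = t + k := by omega
  rw [h1, h2]

theorem stream_linThr {d : ℕ} (w : ℕ → ℝ) (x : List Bool) (hx : x.length = d) (t : ℕ) :
    stream (linThr fun k : Fin d => w k) x (d + t) =
      decide (0 ≤ ∑ k ∈ Finset.range d,
        w k * bit (stream (linThr fun k : Fin d => w k) x (t + k))) := by
  subst hx
  conv_lhs => rw [stream]
  rw [if_neg (by omega), Nat.add_sub_cancel_left,
    linThr_eq_of_length w _ (length_iterate_appendStep _ x t)]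
  congr 2
  refine Finset.sum_congr rfl fun k hk => ?_
  rw [Finset.mem_range] at hk
  rw [getD_iterate_appendStep _ _ _ _ (by omega)]

/-- Word of length `d` carrying the bit `X q` at the last position of the `q`-th block of
length `T`, and zeros elsewhere. -/
def spread (d T : ℕ) (X : ℕ → Bool) : List Bool :=
  List.ofFn fun p : Fin d => if (p : ℕ) % T = T - 1 then X (p / T) else false

theorem length_spread (d T : ℕ) (X : ℕ → Bool) : (spread d T X).length = d := by
  simp [spread]

theorem stream_spread {d T : ℕ} (X : ℕ → Bool) (f : List Bool → Bool) {p : ℕ} (hp : p < d) :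
    stream f (spread d T X) p = if p % T = T - 1 then X (p / T) else false := by
  rw [stream, length_spread, if_pos hp]
  simp [spread, hp]

/-- Weights which, at time `t`, assign `W t q` to the bit carried by the `q`-th block. -/
def blockWeight (T : ℕ) (W : ℕ → ℕ → ℝ) (k : ℕ) : ℝ := W (T - 1 - k % T) (k / T)

theorem blockWeight_sub {T : ℕ} (W : ℕ → ℕ → ℝ) (q : ℕ) {t : ℕ} (ht : t < T) :
    blockWeight T W (q * T + (T - 1 - t)) = W t q := by
  have h1 : (q * T + (T - 1 - t)) % T = T - 1 - t := by
    rw [mul_comm, Nat.mul_add_mod, Nat.mod_eq_of_lt (by omega)]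
  have h2 : (q * T + (T - 1 - t)) / T = q := by
    rw [mul_comm, Nat.mul_add_div (by omega), Nat.div_eq_of_lt (by omega), add_zero]
  rw [blockWeight, h1, h2]
  congr 1
  omega

/-- On a spread word with block weights, the `t`-th generated bit is a threshold of the carried
bits with weights `W t q` and of the earlier generated bits with weights depending only on the
time lag. -/
theorem stream_spread_blockWeight {d n T : ℕ} (hd : d = (n + 1) * T + (T - 1)) (W : ℕ → ℕ → ℝ)
    (X : ℕ → Bool) {t : ℕ} (ht : t < T) :
    stream (linThr fun k : Fin d => blockWeight T W k) (spread d T X) (d + t) =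
      decide (0 ≤ ∑ q ∈ Finset.range (n + 1), W t q * bit (X q) +
        ∑ i ∈ Finset.range t, W (t - i) (n + 1) *
          bit (stream (linThr fun k : Fin d => blockWeight T W k) (spread d T X) (d + i))) := by
  rw [stream_linThr _ _ (length_spread d T X)]
  set f := linThr fun k : Fin d => blockWeight T W k
  congr 2
  have hsplit : Finset.range d = Finset.range ((d - t) + t) := by congr 1; omega
  rw [hsplit, Finset.sum_range_add]
  congr 1
  · symm
    have hq (q : ℕ) (hq : q ∈ Finset.range (n + 1)) : q * T + T ≤ (n + 1) * T := by
      rw [Finset.mem_range] at hq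
      nlinarith
    refine Finset.sum_of_injOn (fun q => q * T + (T - 1 - t)) ?_ ?_ ?_ ?_
    · intro a _ b _ hab
      exact Nat.eq_of_mul_eq_mul_right (by omega : 0 < T) (by simpa using hab)
    · intro q hmem
      have := hq q hmem
      simp only [Finset.coe_range, Set.mem_Iio]
      omega
    · intro k hk hnot
      rw [Finset.mem_range] at hk
      rw [stream_spread X f (by omega), if_neg]
      · simp [bit]
      · intro hmod
        apply hnot
        have hdm := Nat.div_add_mod (t + k) T
        rw [hmod, mul_comm] at hdm
        refine ⟨(t + k) / T, ?_, ?_⟩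
        · simp only [Finset.coe_range, Set.mem_Iio]
          by_contra! hge
          have := Nat.mul_le_mul_right T hge
          omega
        · dsimp only
          omega
    · intro q hmem
      have := hq q hmem
      have h1 : t + (q * T + (T - 1 - t)) = q * T + (T - 1) := by omega
      rw [blockWeight_sub W q ht, stream_spread X f (by omega), h1,
        mul_comm q T, Nat.mul_add_mod, Nat.mod_eq_of_lt (by omega), if_pos rfl,
        Nat.mul_add_div (by omega), Nat.div_eq_of_lt (by omega), add_zero]
  · refine Finset.sum_congr rfl fun i hi => ?_
    rw [Finset.mem_range] at hi
    have h1 : d - t + i = (n + 1) * T + (T - 1 - (t - i)) := by omega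
    have h2 : t + (d - t + i) = d + i := by omega
    rw [h2, h1, blockWeight_sub W (n + 1) (by omega)]

/-- Input bits followed by a constant `true` used for biases. -/
def biasedInput {n : ℕ} (x : Fin n → Bool) (q : ℕ) : Bool :=
  if h : q < n then x ⟨q, h⟩ else true

/-- Weights simulating a circuit: the hidden gates are computed at times `t < s - 1` and the
output gate at time `2 * s - 2`; block `n` carries the biases, and column `n + 1` holds the
weights of the generated bits by time lag. -/
def Depth2Circuit.timeWeight {n s : ℕ} (C : Depth2Circuit n s) (t q : ℕ) : ℝ :=
  if hq : q < n then
    if ht : t < s - 1 then C.hw ⟨t, ht⟩ ⟨q, hq⟩ else 0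
  else if q = n then
    if ht : t < s - 1 then C.hb ⟨t, ht⟩ else if t = 2 * s - 2 then C.ob else 0
  else if h : s ≤ t ∧ t < 2 * s - 1 then C.ow ⟨2 * s - 2 - t, by omega⟩ else 0

theorem sum_timeWeight_hidden {n s : ℕ} (C : Depth2Circuit n s) (x : Fin n → Bool)
    (t : Fin (s - 1)) :
    ∑ q ∈ Finset.range (n + 1), C.timeWeight t q * bit (biasedInput x q) =
      C.hb t + ∑ j, C.hw t j * bit (x j) := by
  rw [Finset.sum_range_succ, Finset.sum_range, add_comm]
  simp [Depth2Circuit.timeWeight, biasedInput, bit]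

theorem sum_timeWeight_output {n s : ℕ} (C : Depth2Circuit n s) (x : Fin n → Bool) (hs : 2 ≤ s) :
    ∑ q ∈ Finset.range (n + 1), C.timeWeight (2 * s - 2) q * bit (biasedInput x q) = C.ob := by
  have h : ¬ 2 * s - 2 < s - 1 := by omega
  rw [Finset.sum_range_succ, Finset.sum_range]
  simp [Depth2Circuit.timeWeight, biasedInput, bit, h]

theorem timeWeight_lag_of_lt {n s : ℕ} (C : Depth2Circuit n s) {t : ℕ} (ht : t < s) :
    C.timeWeight t (n + 1) = 0 := by
  simp [Depth2Circuit.timeWeight, ht.not_ge]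

theorem timeWeight_lag_output {n s : ℕ} (C : Depth2Circuit n s) (i : Fin (s - 1)) :
    C.timeWeight (2 * s - 2 - i) (n + 1) = C.ow i := by
  have hi := i.isLt
  have h : s ≤ 2 * s - 2 - i := by omega
  have h1 : 2 * s - 2 - i < 2 * s - 1 := by omega
  have h2 : 2 * s - 2 - (2 * s - 2 - i) = (i : ℕ) := by omega
  simp [Depth2Circuit.timeWeight, h, h1, h2]

/-- **Simulation of depth-2 threshold circuits by autoregressive linear thresholds.**
For every `n ≥ 1` and `s ≥ 2`, with `d = n(2s−1)+4s−3` and `T = 2s−1`, there is a map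
`φ : {0,1}^n → {0,1}^d` (depending only on `n` and `s`) such that for every depth-2 linear
threshold circuit `C` of size `s` over `{0,1}^n` there exists `w ∈ ℝ^d` with
`ete_{f_w}^T(φ(x)) = C(x)` for all `x`. -/
theorem stmt0 (n s : ℕ) (hn : 1 ≤ n) (hs : 2 ≤ s) :
    ∃ φ : (Fin n → Bool) → List Bool,
      (∀ x, (φ x).length = n * (2 * s - 1) + 4 * s - 3) ∧
      ∀ C : Depth2Circuit n s,
        ∃ w : Fin (n * (2 * s - 1) + 4 * s - 3) → ℝ,
          ∀ x : Fin n → Bool, eteFn (linThr w) (2 * s - 1) (φ x) = C.out x := by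
  have hd : n * (2 * s - 1) + 4 * s - 3 = (n + 1) * (2 * s - 1) + (2 * s - 1 - 1) := by
    rw [add_mul]
    omega
  generalize n * (2 * s - 1) + 4 * s - 3 = d at hd
  refine ⟨fun x => spread d (2 * s - 1) (biasedInput x), fun x => length_spread _ _ _,
    fun C => ⟨fun k => blockWeight (2 * s - 1) C.timeWeight k, fun x => ?_⟩⟩
  have key {t : ℕ} (ht : t < 2 * s - 1) :=
    stream_spread_blockWeight hd C.timeWeight (biasedInput x) ht
  set f := linThr fun k : Fin d => blockWeight (2 * s - 1) C.timeWeight k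
  have hidden (i : Fin (s - 1)) :
      stream f (spread d (2 * s - 1) (biasedInput x)) (d + i) = C.gate i x := by
    have hi := i.isLt
    have hzero (j : ℕ) : C.timeWeight (i - j) (n + 1) = 0 := timeWeight_lag_of_lt C (by omega)
    rw [key (by omega), sum_timeWeight_hidden]
    simp only [hzero, zero_mul, Finset.sum_const_zero, add_zero]
    rfl
  have hT : 2 * s - 1 = 2 * s - 2 + 1 := by omega
  have hlag : ∑ i ∈ Finset.range (2 * s - 2), C.timeWeight (2 * s - 2 - i) (n + 1) *
      bit (stream f (spread d (2 * s - 1) (biasedInput x)) (d + i)) =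
      ∑ i, C.ow i * bit (C.gate i x) := by
    rw [← Finset.sum_subset (Finset.range_subset_range.2 (by omega : s - 1 ≤ 2 * s - 2)),
      Finset.sum_range]
    · simp only [timeWeight_lag_output, hidden]
    · intro i _ hi
      rw [Finset.mem_range] at hi
      rw [timeWeight_lag_of_lt C (by omega), zero_mul]
  calc eteFn f (2 * s - 1) (spread d (2 * s - 1) (biasedInput x))
      = stream f (spread d (2 * s - 1) (biasedInput x)) (d + (2 * s - 2)) := by
        conv_lhs => rw [congrArg (eteFn f) hT, eteFn_succ, length_spread]
    _ = C.out x := by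
        rw [key (by omega), sum_timeWeight_output C x hs, hlag]
        rfl

end CoTPaper
end

section
/- For every n ≥ 1 and s ≥ 2, with d = n(2s−1)+4s−3, T = 2s−1, and the map φ : {0,1}^n → {0,1}^d from the simulation lemma, there exist a set I ⊆ [T] with |I| = s and an injective map φ' : [s] → I, both depending only on s, such that for every depth-2 linear threshold circuit C of size s over {0,1}^n the weight vector w ∈ ℝ^d can be chosen so that simultaneously: (1) ete_{f_w}^{φ'(t)}(φ(x)) = C_t(x) for all x ∈ {0,1}^n and all t ∈ [s] (where C_s = C is the output gate); (2) ete_{f_w}^{t'}(φ(x)) = 0 for all x ∈ {0,1}^n and all t' ∈ [T] \ I; in particular ete_{f_w}^T(φ(x)) = C(x). -/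
open scoped Classical

namespace CoTPaper

/-- `C_t(x)` for `t ∈ [s]` (zero-indexed here as `t : Fin s`): the hidden gates for
`t < s − 1`, and the output gate for the last index, so `C_s = C` is the output gate. -/
noncomputable def Depth2Circuit.val {n s : ℕ} (C : Depth2Circuit n s)
    (t : Fin s) (x : Fin n → Bool) : Bool :=
  if h : (t : ℕ) < s - 1 then C.gate ⟨t, h⟩ x else C.out x

/-- The sum inside `linThr`, written from the last bit backwards over a range. -/
theorem linThr_ofRev {d : ℕ} (W : ℕ → ℝ) (z : List Bool) (hz : d ≤ z.length) :
    linThr (fun i : Fin d => W (d - i)) z =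
      decide (0 ≤ ∑ i ∈ Finset.range d,
        W (i + 1) * (if z.getD (z.length - 1 - i) false then (1 : ℝ) else 0)) := by
  have key : (∑ i : Fin (min d z.length),
      W (d - ((Fin.castLE (min_le_left d z.length) i).rev : Fin d)) *
        (if z.getD (z.length - 1 - (i : ℕ)) false then (1 : ℝ) else 0)) =
      ∑ i ∈ Finset.range d,
        W (i + 1) * (if z.getD (z.length - 1 - i) false then (1 : ℝ) else 0) := by
    have range_eq : Finset.range d = Finset.range (min d z.length) := by rw [min_eq_left hz]
    rw [range_eq, Finset.sum_range]
    refine Finset.sum_congr rfl fun i _ => ?_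
    have hi := i.isLt
    have : d - ((Fin.castLE (min_le_left d z.length) i).rev : Fin d).val = i.val + 1 := by
      rw [Fin.val_rev, Fin.val_castLE]; omega
    rw [this]
  unfold linThr
  rw [key]

/-- If a generator reproduces the sequence `y` on top of `x` for `T` steps, then its end-to-end
value after `t + 1 ≤ T` steps is `y t`. -/
theorem eteFn_succ_eq {f : List Bool → Bool} {x : List Bool} {y : ℕ → Bool} {T : ℕ}
    (h : ∀ r < T, f (x ++ (List.range r).map y) = y r) {t : ℕ} (ht : t < T) :
    eteFn f (t + 1) x = y t := by
  have iter : ∀ r ≤ T, (appendStep f)^[r] x = x ++ (List.range r).map y := by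
    intro r
    induction r with
    | zero => simp
    | succ r ih =>
      intro hr
      rw [Function.iterate_succ_apply', ih (by omega), appendStep, h r (by omega)]
      simp [List.range_succ]
  rw [eteFn, iter (t + 1) (by omega)]
  simp [List.range_succ, List.getLastD_eq_getLast?]

/-- The list of length `d` whose `k`-th bit from the end (counting from one) is `e k`. -/
def revList (d : ℕ) (e : ℕ → Bool) : List Bool := (List.range d).map fun m => e (d - m)

/-- Window sum for the list `revList d e` followed by the bits `y 0, …, y (r - 1)`. -/
theorem linThr_revList_append {d r : ℕ} (hr : r ≤ d) (W : ℕ → ℝ) (e y : ℕ → Bool) :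
    linThr (fun i : Fin d => W (d - i)) (revList d e ++ (List.range r).map y) =
      decide (0 ≤ ∑ i ∈ Finset.range r, W (r - i) * (if y i then (1 : ℝ) else 0) +
        ∑ k ∈ Finset.range (d - r), W (k + 1 + r) * (if e (k + 1) then (1 : ℝ) else 0)) := by
  rw [linThr_ofRev W _ (by simp [revList])]
  obtain ⟨c, rfl⟩ := Nat.exists_eq_add_of_le hr
  rw [Finset.sum_range_add, ← Finset.sum_range_reflect _ r]
  have len : (revList (r + c) e).length = r + c := by simp [revList]
  have h₁ : ∀ i ∈ Finset.range r,
      W (r - 1 - i + 1) * (if (revList (r + c) e ++ (List.range r).map y).getD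
        ((revList (r + c) e ++ (List.range r).map y).length - 1 - (r - 1 - i)) false
          then (1 : ℝ) else 0) = W (r - i) * (if y i then (1 : ℝ) else 0) := by
    intro i hi
    have hi := Finset.mem_range.1 hi
    rw [List.getD_append_right _ _ _ _ (by simp [revList]; omega), List.length_append, len,
      List.length_map, List.length_range,
      show r + c + r - 1 - (r - 1 - i) - (r + c) = i by omega,
      show r - 1 - i + 1 = r - i by omega]
    simp [List.getD_eq_getElem?_getD, hi]
  have h₂ : ∀ k ∈ Finset.range c,
      W (r + k + 1) * (if (revList (r + c) e ++ (List.range r).map y).getD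
        ((revList (r + c) e ++ (List.range r).map y).length - 1 - (r + k)) false
          then (1 : ℝ) else 0) = W (k + 1 + r) * (if e (k + 1) then (1 : ℝ) else 0) := by
    intro k hk
    have hk := Finset.mem_range.1 hk
    rw [List.length_append, len, List.length_map, List.length_range,
      List.getD_append _ _ _ _ (by rw [len]; omega),
      show r + k + 1 = k + 1 + r by omega,
      show r + c + r - 1 - (r + k) = r + c - 1 - k by omega]
    have hlt : r + c - 1 - k < r + c := by omega
    simp [List.getD_eq_getElem?_getD, revList, hlt,
      show r + c - (r + c - 1 - k) = k + 1 by omega]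
  rw [Finset.sum_congr rfl h₁, Finset.sum_congr rfl h₂, Nat.add_sub_cancel_left]

/-- The encoding of `x`, read from the end: a constant one at position `M`, the bits of `x` at
the positions `2 * M, …, (n + 1) * M`, and zeros elsewhere. -/
def encBit {n : ℕ} (M : ℕ) (x : Fin n → Bool) (k : ℕ) : Bool :=
  decide (M ∣ k) && (decide (k / M = 1) || if h : k / M - 2 < n then x ⟨k / M - 2, h⟩ else false)

/-- The sum over the encoded input reduces to the bias position and the positions of `x`. -/
theorem sum_encBit {n M N : ℕ} (hM : 0 < M) (hN : (n + 1) * M ≤ N) (hN' : N < (n + 2) * M)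
    (x : Fin n → Bool) (g : ℕ → ℝ) :
    ∑ k ∈ Finset.range N, g (k + 1) * (if encBit M x (k + 1) then (1 : ℝ) else 0) =
      g M + ∑ j : Fin n, g ((j + 2) * M) * (if x j then (1 : ℝ) else 0) := by
  have pos : ∀ q, (q + 1) * M - 1 + 1 = (q + 1) * M := fun q =>
    Nat.sub_add_cancel (Nat.mul_pos q.succ_pos hM)
  have reindex : ∑ q ∈ Finset.range (n + 1),
      g ((q + 1) * M) * (if encBit M x ((q + 1) * M) then (1 : ℝ) else 0) =
      ∑ k ∈ Finset.range N, g (k + 1) * (if encBit M x (k + 1) then (1 : ℝ) else 0) := by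
    refine Finset.sum_of_injOn (fun q => (q + 1) * M - 1) ?_ ?_ ?_ ?_
    · intro a _ b _ hab
      have h : (a + 1) * M = (b + 1) * M := by
        rw [← pos a, ← pos b]; exact congrArg (· + 1) hab
      simpa using Nat.eq_of_mul_eq_mul_right hM h
    · intro q hq
      have hq : q + 1 ≤ n + 1 := by simpa using hq
      have h₁ := Nat.mul_le_mul_right M hq
      have h₂ := pos q
      simp only [Finset.coe_range, Set.mem_Iio]
      omega
    · intro k hk hk'
      have hk := Finset.mem_range.1 hk
      have hdvd : ¬ M ∣ k + 1 := by
        rintro ⟨q, hq⟩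
        apply hk'
        rcases q with _ | q
        · simp at hq
        rw [mul_comm] at hq
        refine ⟨q, ?_, ?_⟩
        · have : (q + 1) * M < (n + 2) * M := by omega
          have := Nat.lt_of_mul_lt_mul_right this
          simp only [Finset.coe_range, Set.mem_Iio]
          omega
        · change (q + 1) * M - 1 = k
          omega
      simp [encBit, hdvd]
    · intro q _
      simp only [pos]
  rw [← reindex, Finset.sum_range_succ', add_comm, Finset.sum_range]
  congr 1
  · simp [encBit, Nat.div_self hM]
  · refine Finset.sum_congr rfl fun j _ => ?_
    simp [encBit, Nat.mul_div_cancel _ hM, add_assoc]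

namespace Depth2Circuit

variable {n s : ℕ} (C : Depth2Circuit n s)

/-- The bit that the simulation produces in step `r + 1`. -/
noncomputable def trace (x : Fin n → Bool) (r : ℕ) : Bool :=
  if h : r < s - 1 then C.gate ⟨r, h⟩ x else if r = 2 * s - 2 then C.out x else false

/-- Weights on the last `2 * s - 2` bits, which hold the bits generated so far. -/
noncomputable def recentWeight (k : ℕ) : ℝ :=
  if h : s ≤ k ∧ k < 2 * s - 1 then C.ow ⟨2 * s - 2 - k, by omega⟩ else 0

/-- Weight of the constant bit in step `r + 1`. -/
noncomputable def biasWeight (r : ℕ) : ℝ :=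
  if h : r < s - 1 then C.hb ⟨r, h⟩
  else if r = 2 * s - 2 then C.ob
  else -1 - ∑ k ∈ Finset.range (2 * s), |C.recentWeight k|

/-- Weight of the input bit `x j` in step `r + 1`. -/
noncomputable def inputWeight (j r : ℕ) : ℝ :=
  if h : r < s - 1 ∧ j < n then C.hw ⟨r, h.1⟩ ⟨j, h.2⟩ else 0

/-- All weights of the simulation, indexed from the end (counting from one). -/
noncomputable def simWeight (k : ℕ) : ℝ :=
  if k < 2 * s - 1 then C.recentWeight k
  else if k / (2 * s - 1) = 1 then C.biasWeight (k % (2 * s - 1))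
  else C.inputWeight (k / (2 * s - 1) - 2) (k % (2 * s - 1))

theorem simWeight_bias {r : ℕ} (hr : r < 2 * s - 1) :
    C.simWeight (2 * s - 1 + r) = C.biasWeight r := by
  have hM : 0 < 2 * s - 1 := by omega
  simp [simWeight, Nat.add_div_left, Nat.div_eq_of_lt hr, Nat.mod_eq_of_lt hr, hM]

theorem simWeight_input {r : ℕ} (hr : r < 2 * s - 1) (j : ℕ) :
    C.simWeight ((j + 2) * (2 * s - 1) + r) = C.inputWeight j r := by
  have hM : 0 < 2 * s - 1 := by omega
  have hle : 2 * s - 1 ≤ (j + 2) * (2 * s - 1) := Nat.le_mul_of_pos_left _ (by omega)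
  have hdiv : ((j + 2) * (2 * s - 1) + r) / (2 * s - 1) = j + 2 := by
    rw [add_comm, Nat.add_mul_div_right _ _ hM, Nat.div_eq_of_lt hr, zero_add]
  have hmod : ((j + 2) * (2 * s - 1) + r) % (2 * s - 1) = r := by
    rw [add_comm, Nat.add_mul_mod_self_right, Nat.mod_eq_of_lt hr]
  rw [simWeight, if_neg (by omega), hdiv, hmod, if_neg (by omega)]
  simp

/-- The bits generated so far contribute nothing while the hidden gates are evaluated. -/
theorem sum_recentWeight_hidden {r : ℕ} (hr : r < s - 1) (y : ℕ → Bool) :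
    ∑ i ∈ Finset.range r, C.recentWeight (r - i) * (if y i then (1 : ℝ) else 0) = 0 := by
  refine Finset.sum_eq_zero fun i _ => ?_
  rw [recentWeight, dif_neg (by omega), zero_mul]

theorem sum_recentWeight_le {r : ℕ} (hr : r < 2 * s) (y : ℕ → Bool) :
    ∑ i ∈ Finset.range r, C.recentWeight (r - i) * (if y i then (1 : ℝ) else 0) ≤
      ∑ k ∈ Finset.range (2 * s), |C.recentWeight k| := by
  calc _ ≤ ∑ i ∈ Finset.range r, |C.recentWeight (r - i)| := by
        refine Finset.sum_le_sum fun i _ => ?_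
        split_ifs
        · simpa using le_abs_self _
        · simp
    _ = ∑ i ∈ Finset.range r, |C.recentWeight (i + 1)| := by
        rw [← Finset.sum_range_reflect]
        refine Finset.sum_congr rfl fun i hi => ?_
        have := Finset.mem_range.1 hi
        congr 2
        omega
    _ ≤ ∑ i ∈ Finset.range (r + 1), |C.recentWeight i| := by
        rw [Finset.sum_range_succ']
        exact le_add_of_nonneg_right (abs_nonneg _)
    _ ≤ _ := Finset.sum_le_sum_of_subset_of_nonneg (Finset.range_subset_range.2 (by omega))
        fun _ _ _ => abs_nonneg _

theorem sum_recentWeight_out (hs : 1 ≤ s) (x : Fin n → Bool) :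
    ∑ i ∈ Finset.range (2 * s - 2),
        C.recentWeight (2 * s - 2 - i) * (if C.trace x i then (1 : ℝ) else 0) =
      ∑ i, C.ow i * (if C.gate i x then (1 : ℝ) else 0) := by
  rw [show 2 * s - 2 = (s - 1) + (s - 1) by omega, Finset.sum_range_add, Finset.sum_range]
  rw [Finset.sum_eq_zero (s := Finset.range (s - 1)), add_zero]
  · refine Finset.sum_congr rfl fun i _ => ?_
    have hi := i.isLt
    rw [recentWeight, dif_pos (by omega), trace, dif_pos hi]
    congr 2
    ext
    simp only
    omega
  · intro i _
    rw [recentWeight, dif_neg (by omega), zero_mul]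

theorem linThr_simWeight (hs : 1 ≤ s) {d : ℕ} (hd : d = n * (2 * s - 1) + 4 * s - 3)
    (x : Fin n → Bool) {r : ℕ} (hr : r < 2 * s - 1) :
    linThr (fun i : Fin d => C.simWeight (d - i))
      (revList d (encBit (2 * s - 1) x) ++ (List.range r).map (C.trace x)) = C.trace x r := by
  have e₁ : (n + 1) * (2 * s - 1) = n * (2 * s - 1) + (2 * s - 1) := by ring
  have e₂ : (n + 2) * (2 * s - 1) = n * (2 * s - 1) + 2 * (2 * s - 1) := by ring
  rw [linThr_revList_append (by omega),
    sum_encBit (by omega) (by omega) (by omega) x fun k => C.simWeight (k + r),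
    C.simWeight_bias hr]
  simp only [C.simWeight_input hr]
  have recent : ∑ i ∈ Finset.range r,
      C.simWeight (r - i) * (if C.trace x i then (1 : ℝ) else 0) =
      ∑ i ∈ Finset.range r, C.recentWeight (r - i) * (if C.trace x i then (1 : ℝ) else 0) :=
    Finset.sum_congr rfl fun i _ => by rw [simWeight, if_pos (by omega)]
  rw [recent]
  by_cases h : r < s - 1
  · rw [C.sum_recentWeight_hidden h, zero_add, biasWeight, dif_pos h, trace, dif_pos h, gate]
    simp [inputWeight, h]
  · have input : ∑ j : Fin n, C.inputWeight j r * (if x j then (1 : ℝ) else 0) = 0 :=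
      Finset.sum_eq_zero fun j _ => by simp [inputWeight, h]
    rw [input, add_zero, biasWeight, dif_neg h]
    by_cases h' : r = 2 * s - 2
    · rw [if_pos h', trace, dif_neg h, if_pos h', out, h', C.sum_recentWeight_out hs, add_comm]
    · rw [if_neg h', trace, dif_neg h, if_neg h', decide_eq_false_iff_not]
      have := C.sum_recentWeight_le (r := r) (by omega) (C.trace x)
      linarith

end Depth2Circuit

/-- **CoT-preserving simulation of depth-2 threshold circuits.**  For every `s ≥ 2`, with
`T = 2s−1`, there are a set `I ⊆ [T]` with `|I| = s` and an injective `φ' : [s] → I`, both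
depending only on `s`, such that for every `n ≥ 1` there is a map
`φ : {0,1}^n → {0,1}^d` with `d = n(2s−1)+4s−3` such that for every depth-2 linear
threshold circuit `C` of size `s` the weight vector `w ∈ ℝ^d` can be chosen so that
simultaneously: (1) `ete_{f_w}^{φ'(t)}(φ(x)) = C_t(x)` for all `x` and `t ∈ [s]`;
(2) `ete_{f_w}^{t'}(φ(x)) = 0` for all `x` and all `t' ∈ [T] \ I`; and in particular
`ete_{f_w}^T(φ(x)) = C(x)`. -/
theorem stmt1 (s : ℕ) (hs : 2 ≤ s) :
    ∃ (I : Finset ℕ) (φ' : Fin s → ℕ),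
      I ⊆ Finset.Icc 1 (2 * s - 1) ∧ I.card = s ∧
      Function.Injective φ' ∧ (∀ t, φ' t ∈ I) ∧
      ∀ n : ℕ, 1 ≤ n →
        ∃ φ : (Fin n → Bool) → List Bool,
          (∀ x, (φ x).length = n * (2 * s - 1) + 4 * s - 3) ∧
          ∀ C : Depth2Circuit n s,
            ∃ w : Fin (n * (2 * s - 1) + 4 * s - 3) → ℝ,
              (∀ (x : Fin n → Bool) (t : Fin s),
                  eteFn (linThr w) (φ' t) (φ x) = C.val t x) ∧
              (∀ (x : Fin n → Bool), ∀ t' ∈ Finset.Icc 1 (2 * s - 1), t' ∉ I →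
                  eteFn (linThr w) t' (φ x) = false) ∧
              (∀ x : Fin n → Bool,
                  eteFn (linThr w) (2 * s - 1) (φ x) = C.out x) := by
  set φ' : Fin s → ℕ := fun t => if (t : ℕ) < s - 1 then (t : ℕ) + 1 else 2 * s - 1 with hφ'
  have inj : Function.Injective φ' := by
    intro a b hab
    have ha := a.isLt
    have hb := b.isLt
    simp only [hφ'] at hab
    ext
    split_ifs at hab <;> omega
  refine ⟨Finset.univ.image φ', φ', ?_, ?_, inj, fun t => Finset.mem_image_of_mem _ (by simp), ?_⟩
  · intro k hk
    obtain ⟨t, -, rfl⟩ := Finset.mem_image.1 hk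
    simp only [hφ', Finset.mem_Icc]
    split_ifs <;> omega
  · rw [Finset.card_image_of_injective _ inj, Finset.card_univ, Fintype.card_fin]
  intro n _
  refine ⟨fun x => revList (n * (2 * s - 1) + 4 * s - 3) (encBit (2 * s - 1) x),
    fun x => by simp [revList], fun C =>
    ⟨fun i => C.simWeight (n * (2 * s - 1) + 4 * s - 3 - i), ?_⟩⟩
  have ete (x : Fin n → Bool) {t : ℕ} (ht : t < 2 * s - 1) :=
    eteFn_succ_eq (fun r hr => C.linThr_simWeight (by omega) rfl x hr) ht
  have eteOut (x : Fin n → Bool) := ete x (t := 2 * s - 2) (by omega)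
  rw [show 2 * s - 2 + 1 = 2 * s - 1 by omega] at eteOut
  have traceOut (x : Fin n → Bool) : C.trace x (2 * s - 2) = C.out x := by
    rw [Depth2Circuit.trace, dif_neg (by omega), if_pos rfl]
  simp only [traceOut] at eteOut
  refine ⟨fun x t => ?_, fun x t' ht' hI => ?_, eteOut⟩
  · by_cases h : (t : ℕ) < s - 1
    · simp only [hφ', if_pos h]
      rw [ete x (by omega), Depth2Circuit.trace, dif_pos h, Depth2Circuit.val, dif_pos h]
    · simp only [hφ', if_neg h]
      rw [eteOut, Depth2Circuit.val, dif_neg h]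
  · obtain ⟨h₁, h₂⟩ := Finset.mem_Icc.1 ht'
    obtain ⟨t, rfl⟩ := Nat.exists_eq_add_of_le' h₁
    have ne (u : Fin s) : φ' u ≠ t + 1 := fun h =>
      hI (Finset.mem_image.2 ⟨u, Finset.mem_univ u, h⟩)
    have hidden : ¬ t < s - 1 := fun h => ne ⟨t, by omega⟩ (by simp [hφ', h])
    have last : t ≠ 2 * s - 2 := fun h => ne ⟨s - 1, by omega⟩ (by simp [hφ']; omega)
    rw [ete x (by omega), Depth2Circuit.trace, dif_neg hidden, if_neg last]

end CoTPaper
end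

section
/- Let (x_1,y_1),…,(x_m,y_m) be a training set with y_i ∈ {−1,+1}, and let h_1,…,h_K : X → {−1,+1}. Define D^{(1)}_i = 1/m for all i; for k = 1,…,K let ε_k = ∑_{i=1}^m D^{(k)}_i · 1[h_k(x_i) ≠ y_i], assume ε_k ∈ (0,1), set α_k = (1/2)·ln((1−ε_k)/ε_k), and D^{(k+1)}_i = D^{(k)}_i · exp(−α_k y_i h_k(x_i)) / Z_k where Z_k = ∑_{i=1}^m D^{(k)}_i · exp(−α_k y_i h_k(x_i)). Let F_K(x) = ∑_{k=1}^K α_k h_k(x). Then (1/m)·|{i ∈ [m] : y_i F_K(x_i) ≤ 0}| ≤ ∏_{k=1}^K 2√(ε_k(1−ε_k)). -/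
open scoped Classical

/-- The optimal AdaBoost coefficient `½ ln((1-ε)/ε)` gives the normalizer `2√(ε(1-ε))`. -/
lemma adaBoost_normalizer_eq {ε α : ℝ} (h0 : 0 < ε) (h1 : ε < 1)
    (hα : α = (1 / 2) * Real.log ((1 - ε) / ε)) :
    ε * Real.exp α + (1 - ε) * Real.exp (-α) = 2 * Real.sqrt (ε * (1 - ε)) := by
  have h1' : 0 < 1 - ε := by linarith
  have hexp : Real.exp α = Real.sqrt (1 - ε) / Real.sqrt ε := by
    rw [hα, ← Real.sqrt_div h1'.le, one_div_mul_eq_div, ← Real.log_sqrt (by positivity),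
      Real.exp_log (by positivity)]
  rw [Real.exp_neg, hexp, Real.sqrt_mul h0.le]
  have hp : 0 < Real.sqrt ε := Real.sqrt_pos.2 h0
  have hq : 0 < Real.sqrt (1 - ε) := Real.sqrt_pos.2 h1'
  have hp2 := Real.sq_sqrt h0.le
  have hq2 := Real.sq_sqrt h1'.le
  generalize Real.sqrt ε = p at *
  generalize Real.sqrt (1 - ε) = q at *
  rw [← hq2, ← hp2]
  field_simp
  ring

/-- Reweighting a vector of total weight one by `exp(∓α)` has total mass determined by the
weighted error. -/
lemma sum_mul_exp_neg_mul_eq {ι : Type*} [Fintype ι] (w y g : ι → ℝ) (a : ℝ)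
    (hw : ∑ i, w i = 1) (hy : ∀ i, y i = 1 ∨ y i = -1) (hg : ∀ i, g i = 1 ∨ g i = -1) :
    ∑ i, w i * Real.exp (-a * (y i * g i)) =
      (∑ i, w i * (if g i ≠ y i then 1 else 0)) * Real.exp a +
        (1 - ∑ i, w i * (if g i ≠ y i then 1 else 0)) * Real.exp (-a) := by
  rw [← hw, ← Finset.sum_sub_distrib, Finset.sum_mul, Finset.sum_mul, ← Finset.sum_add_distrib]
  refine Finset.sum_congr rfl fun i _ => ?_
  rcases hy i with h | h <;> rcases hg i with h' | h' <;> rw [h, h'] <;> norm_num [hw]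

/-- **AdaBoost training-error bound.**  Given a training set `(x_i, y_i)` with labels in
`{−1,+1}`, weak hypotheses `h_1,…,h_K` with values in `{−1,+1}`, the AdaBoost weights
`D^{(k)}`, weighted errors `ε_k ∈ (0,1)`, coefficients `α_k = ½·ln((1−ε_k)/ε_k)` and
normalizers `Z_k`, the fraction of training examples with `y_i·F_K(x_i) ≤ 0` (where
`F_K = ∑_k α_k h_k`) is at most `∏_{k<K} 2√(ε_k(1−ε_k))`. -/
theorem stmt5 {X : Type*} (m K : ℕ) (hm : 1 ≤ m)
    (x : Fin m → X) (y : Fin m → ℝ) (hy : ∀ i, y i = 1 ∨ y i = -1)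
    (h : ℕ → X → ℝ) (hh : ∀ k < K, ∀ i, h k (x i) = 1 ∨ h k (x i) = -1)
    (D : ℕ → Fin m → ℝ) (ε α Z : ℕ → ℝ)
    (hD0 : ∀ i, D 0 i = 1 / m)
    (hε : ∀ k < K, ε k = ∑ i, D k i * (if h k (x i) ≠ y i then 1 else 0))
    (hε01 : ∀ k < K, ε k ∈ Set.Ioo (0 : ℝ) 1)
    (hα : ∀ k < K, α k = (1 / 2) * Real.log ((1 - ε k) / ε k))
    (hZ : ∀ k < K, Z k = ∑ i, D k i * Real.exp (-(α k) * (y i * h k (x i))))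
    (hDk : ∀ k < K, ∀ i, D (k + 1) i
        = D k i * Real.exp (-(α k) * (y i * h k (x i))) / Z k) :
    (1 / m : ℝ) *
        (Finset.univ.filter
          (fun i : Fin m => y i * ∑ k ∈ Finset.range K, α k * h k (x i) ≤ 0)).card
      ≤ ∏ k ∈ Finset.range K, 2 * Real.sqrt (ε k * (1 - ε k)) := by
  have hZeq : ∀ k < K, ∑ i, D k i = 1 → Z k = 2 * Real.sqrt (ε k * (1 - ε k)) := by
    intro k hk hs
    rw [hZ k hk, sum_mul_exp_neg_mul_eq (D k) y (fun i => h k (x i)) (α k) hs hy (hh k hk),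
      ← hε k hk]
    exact adaBoost_normalizer_eq (hε01 k hk).1 (hε01 k hk).2 (hα k hk)
  have hZpos : ∀ k < K, ∑ i, D k i = 1 → 0 < Z k := by
    intro k hk hs
    rw [hZeq k hk hs]
    have h0 := (hε01 k hk).1
    have h1 : 0 < 1 - ε k := sub_pos.2 (hε01 k hk).2
    positivity
  have hm0 : (0 : ℝ) < m := by exact_mod_cast hm
  have hsum : ∀ k ≤ K, ∑ i, D k i = 1 := by
    intro k
    induction k with
    | zero => intro _; simp [hD0, hm0.ne']
    | succ k ih =>
      intro hk
      rw [Finset.sum_congr rfl fun i _ => hDk k hk i, ← Finset.sum_div, ← hZ k hk]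
      exact div_self (hZpos k hk (ih (Nat.le_of_succ_le hk))).ne'
  have hprod : ∀ k ≤ K, ∀ i, D k i * ∏ j ∈ Finset.range k, Z j =
      1 / m * Real.exp (-(y i * ∑ j ∈ Finset.range k, α j * h j (x i))) := by
    intro k
    induction k with
    | zero => intro _ i; simp [hD0]
    | succ k ih =>
      intro hk i
      have hz := (hZpos k hk (hsum k (Nat.le_of_succ_le hk))).ne'
      have hexp : Real.exp (-(y i * ∑ j ∈ Finset.range (k + 1), α j * h j (x i))) =
          Real.exp (-(y i * ∑ j ∈ Finset.range k, α j * h j (x i))) *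
            Real.exp (-(α k) * (y i * h k (x i))) := by
        rw [← Real.exp_add, Finset.sum_range_succ]
        ring_nf
      rw [hexp, ← mul_assoc, ← ih (Nat.le_of_succ_le hk) i, Finset.prod_range_succ, hDk k hk i]
      field_simp
  calc (1 / m : ℝ) * (Finset.univ.filter
          (fun i : Fin m => y i * ∑ k ∈ Finset.range K, α k * h k (x i) ≤ 0)).card
      = ∑ i, if y i * ∑ k ∈ Finset.range K, α k * h k (x i) ≤ 0 then (1 / m : ℝ) else 0 := by
        rw [← Finset.sum_filter, Finset.sum_const, nsmul_eq_mul, mul_comm]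
    _ ≤ ∑ i, D K i * ∏ j ∈ Finset.range K, Z j := by
        refine Finset.sum_le_sum fun i _ => ?_
        rw [hprod K le_rfl i]
        split_ifs with hi
        · exact le_mul_of_one_le_right (by positivity) (Real.one_le_exp (by linarith))
        · positivity
    _ = ∏ j ∈ Finset.range K, Z j := by rw [← Finset.sum_mul, hsum K le_rfl, one_mul]
    _ = ∏ k ∈ Finset.range K, 2 * Real.sqrt (ε k * (1 - ε k)) :=
        Finset.prod_congr rfl fun k hk =>
          hZeq k (Finset.mem_range.1 hk) (hsum k (Finset.mem_range.1 hk).le)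
end

section
/- Let (x_1,y_1),…,(x_m,y_m) with y_i ∈ {−1,+1} and m ≥ 2, and let h_1,…,h_K : X → {−1,+1} with the AdaBoost weights D^{(k)}, weighted errors ε_k, and coefficients α_k = (1/2)·ln((1−ε_k)/ε_k) as in the AdaBoost update. If ε_k ∈ (0, 1/4] for every k ∈ [K] and K ≥ 8·ln m, then y_i · ∑_{k=1}^K α_k h_k(x_i) > 0 for every i ∈ [m]; that is, the weighted-majority vote classifies every training example correctly. -/
open scoped Classical

/-- The AdaBoost normalizing constant is at most `√(3/4)` when the weighted error is at most
`1/4`. -/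
theorem normalizer_pos_and_le {ε α : ℝ} (hε : ε ∈ Set.Ioc (0 : ℝ) (1 / 4))
    (hα : α = (1 / 2) * Real.log ((1 - ε) / ε)) :
    0 < Real.exp (-α) * (1 - ε) + Real.exp α * ε ∧
      Real.exp (-α) * (1 - ε) + Real.exp α * ε ≤ √(3 / 4) := by
  obtain ⟨h0, h1⟩ := hε
  have hq : 0 < (1 - ε) / ε := div_pos (by linarith) h0
  have hsq : Real.exp α * Real.exp α * ε = 1 - ε := by
    rw [← Real.exp_add, hα, ← two_mul, ← mul_assoc, mul_one_div_cancel two_ne_zero, one_mul,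
      Real.exp_log hq, div_mul_cancel₀ _ h0.ne']
  have hinv : Real.exp (-α) * Real.exp α = 1 := by rw [← Real.exp_add]; simp
  have hZ : Real.exp (-α) * (1 - ε) + Real.exp α * ε = 2 * Real.exp α * ε := by
    linear_combination -Real.exp (-α) * hsq + Real.exp α * ε * hinv
  rw [hZ]
  refine ⟨by positivity, Real.le_sqrt_of_sq_le ?_⟩
  have : (2 * Real.exp α * ε) ^ 2 = 4 * ε * (1 - ε) := by
    linear_combination 4 * ε * hsq
  nlinarith

/-- The exponential loss of a vote agreeing with the label or not, as an affine function of the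
indicator of a mistake. -/
theorem exp_neg_mul_label {a b : ℝ} (α : ℝ) (ha : a = 1 ∨ a = -1) (hb : b = 1 ∨ b = -1) :
    Real.exp (-α * (a * b)) =
      Real.exp (-α) + (Real.exp α - Real.exp (-α)) * (if b ≠ a then 1 else 0) := by
  rcases ha with rfl | rfl <;> rcases hb with rfl | rfl <;> norm_num

theorem sqrt_three_quarters_lt_exp : √(3 / 4 : ℝ) < Real.exp (-(1 / 8)) := by
  rw [Real.sqrt_lt' (Real.exp_pos _), ← Real.exp_nat_mul]
  have := Real.add_one_lt_exp (x := -(1 / 4)) (by norm_num)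
  norm_num at this ⊢
  exact this

/-- **AdaBoost achieves zero training error.**  With the AdaBoost weights `D^{(k)}`,
weighted errors `ε_k`, and coefficients `α_k = ½·ln((1−ε_k)/ε_k)`, if `m ≥ 2`,
`ε_k ∈ (0, 1/4]` for every round `k < K`, and `K ≥ 8·ln m`, then the weighted-majority
vote classifies every training example correctly: `y_i·∑_k α_k h_k(x_i) > 0` for all `i`. -/
theorem stmt6 {X : Type*} (m K : ℕ) (hm : 2 ≤ m)
    (x : Fin m → X) (y : Fin m → ℝ) (hy : ∀ i, y i = 1 ∨ y i = -1)
    (h : ℕ → X → ℝ) (hh : ∀ k < K, ∀ i, h k (x i) = 1 ∨ h k (x i) = -1)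
    (D : ℕ → Fin m → ℝ) (ε α Z : ℕ → ℝ)
    (hD0 : ∀ i, D 0 i = 1 / m)
    (hε : ∀ k < K, ε k = ∑ i, D k i * (if h k (x i) ≠ y i then 1 else 0))
    (hε14 : ∀ k < K, ε k ∈ Set.Ioc (0 : ℝ) (1 / 4))
    (hα : ∀ k < K, α k = (1 / 2) * Real.log ((1 - ε k) / ε k))
    (hZ : ∀ k < K, Z k = ∑ i, D k i * Real.exp (-(α k) * (y i * h k (x i))))
    (hDk : ∀ k < K, ∀ i, D (k + 1) i
        = D k i * Real.exp (-(α k) * (y i * h k (x i))) / Z k)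
    (hK : 8 * Real.log m ≤ (K : ℝ)) :
    ∀ i : Fin m, 0 < y i * ∑ k ∈ Finset.range K, α k * h k (x i) := by
  have hm0 : (0 : ℝ) < m := by exact_mod_cast (by omega : 0 < m)
  have inv : ∀ k ≤ K, (∀ i, 0 < D k i) ∧ ∑ i, D k i = 1 ∧
      ∀ i, Real.exp (-(y i * ∑ j ∈ Finset.range k, α j * h j (x i)))
        ≤ m * D k i * √(3 / 4) ^ k := by
    intro k
    induction k with
    | zero =>
      intro _
      refine ⟨fun i => by rw [hD0]; positivity, ?_, fun i => ?_⟩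
      · simp [hD0, hm0.ne']
      · simp [hD0, hm0.ne']
    | succ k ih =>
      intro hk
      have hkK : k < K := hk
      obtain ⟨hpos, hsum, hle⟩ := ih hkK.le
      have hZk : Z k = Real.exp (-α k) * (1 - ε k) + Real.exp (α k) * ε k := by
        have hsplit : ∀ i, D k i * Real.exp (-(α k) * (y i * h k (x i))) =
            Real.exp (-α k) * D k i + (Real.exp (α k) - Real.exp (-α k)) *
              (D k i * (if h k (x i) ≠ y i then 1 else 0)) := fun i => by
          rw [exp_neg_mul_label _ (hy i) (hh k hkK i)]
          ring
        rw [hZ k hkK, Finset.sum_congr rfl fun i _ => hsplit i, Finset.sum_add_distrib,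
          ← Finset.mul_sum, ← Finset.mul_sum, hsum, ← hε k hkK]
        ring
      obtain ⟨hZpos, hZle⟩ := normalizer_pos_and_le (hε14 k hkK) (hα k hkK)
      rw [← hZk] at hZpos hZle
      have hpos' : ∀ i, 0 < D (k + 1) i := fun i => by
        rw [hDk k hkK i]
        exact div_pos (mul_pos (hpos i) (Real.exp_pos _)) hZpos
      refine ⟨hpos', ?_, fun i => ?_⟩
      · rw [Finset.sum_congr rfl fun i _ => hDk k hkK i, ← Finset.sum_div, ← hZ k hkK,
          div_self hZpos.ne']
      · have hstep : D k i * Real.exp (-(α k) * (y i * h k (x i))) = D (k + 1) i * Z k := by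
          rw [hDk k hkK i, div_mul_cancel₀ _ hZpos.ne']
        calc Real.exp (-(y i * ∑ j ∈ Finset.range (k + 1), α j * h j (x i)))
            = Real.exp (-(y i * ∑ j ∈ Finset.range k, α j * h j (x i)))
                * Real.exp (-(α k) * (y i * h k (x i))) := by
              rw [← Real.exp_add, Finset.sum_range_succ]
              ring_nf
          _ ≤ m * D k i * √(3 / 4) ^ k * Real.exp (-(α k) * (y i * h k (x i))) :=
              mul_le_mul_of_nonneg_right (hle i) (Real.exp_pos _).le
          _ = m * D (k + 1) i * √(3 / 4) ^ k * Z k := by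
              linear_combination m * √(3 / 4) ^ k * hstep
          _ ≤ m * D (k + 1) i * √(3 / 4) ^ k * √(3 / 4) := by
              have := (hpos' i).le
              gcongr
          _ = m * D (k + 1) i * √(3 / 4) ^ (k + 1) := by ring
  intro i
  obtain ⟨hpos, hsum, hle⟩ := inv K le_rfl
  have hD1 : D K i ≤ 1 :=
    hsum ▸ Finset.single_le_sum (fun j _ => (hpos j).le) (Finset.mem_univ i)
  have hlog : 0 < Real.log m := Real.log_pos (by exact_mod_cast hm)
  have hK0 : K ≠ 0 := by
    rintro rfl
    norm_num at hK
    linarith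
  have hlt : Real.exp (-(y i * ∑ k ∈ Finset.range K, α k * h k (x i))) < 1 :=
    calc _ ≤ m * D K i * √(3 / 4) ^ K := hle i
      _ ≤ m * 1 * √(3 / 4) ^ K := by gcongr
      _ < m * 1 * Real.exp (-(1 / 8)) ^ K := by
          gcongr
          exact sqrt_three_quarters_lt_exp
      _ = Real.exp (Real.log m + K * -(1 / 8)) := by
          rw [Real.exp_add, Real.exp_log hm0, Real.exp_nat_mul, mul_one]
      _ ≤ 1 := Real.exp_le_one_iff.2 (by linarith)
  simpa using hlt
end

section
/- Fix a base class F of next-token generators with finite VC dimension D := VCdim(F) ≥ 1 (as a class of {0,1}-valued functions on {0,1}*), a thinking length T ≥ 1, and κ ≥ 1. Then the VC dimension of the loss class L_T^CoT(F;κ) := {ℓ_{f_1,…,f_κ} : f_1,…,f_κ ∈ F with ete_{f_1}^T ≡ ⋯ ≡ ete_{f_κ}^T}, viewed as a class of {0,1}-valued functions on {0,1}* × {0,1}^T, satisfies VCdim(L_T^CoT(F;κ)) ≤ 3·κ·D·log₂(2κT / ln 2). -/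
namespace CoTPaper

/-- Chain of thought: `CoT_f^T(x) = (ete_f^1(x),…,ete_f^T(x))`. -/
def cotFn (f : List Bool → Bool) (T : ℕ) (x : List Bool) : Fin T → Bool :=
  fun t => eteFn f ((t : ℕ) + 1) x

/-- A class `H` of `{0,1}`-valued functions shatters a tuple `s` of points if it realizes
all behavior vectors on it. -/
def ShattersOn {Z : Type*} (H : Set (Z → Bool)) {m : ℕ} (s : Fin m → Z) : Prop :=
  ∀ v : Fin m → Bool, ∃ h ∈ H, ∀ i, h (s i) = v i

/-- The κ-thinker CoT loss class `L_T^CoT(F;κ)` on `{0,1}^* × {0,1}^T`: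
all functions `ℓ_{f_1,…,f_κ}(x,z) = 1[CoT_{f_j}^T(x) ≠ z for every j ∈ [κ]]` where
`f_1,…,f_κ ∈ F` have identical end-to-end functions. -/
def lossClass (F : Set (List Bool → Bool)) (T κ : ℕ) :
    Set (List Bool × (Fin T → Bool) → Bool) :=
  {g | ∃ f : Fin κ → (List Bool → Bool),
      (∀ j, f j ∈ F) ∧ (∀ j j', eteFn (f j) T = eteFn (f j') T) ∧
      g = fun q => decide (∀ j, cotFn (f j) T q.1 ≠ q.2)}

/-- The context reached from `x` after emitting the first `t` tokens of `z`. -/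
def tokenPrefix {T : ℕ} (x : List Bool) (z : Fin T → Bool) (t : ℕ) : List Bool :=
  x ++ (List.ofFn z).take t

lemma tokenPrefix_succ {T : ℕ} (x : List Bool) (z : Fin T → Bool) (t : Fin T) :
    tokenPrefix x z (t + 1) = tokenPrefix x z t ++ [z t] := by
  have ht : (t : ℕ) < (List.ofFn z).length := by simp
  simp only [tokenPrefix, List.append_assoc, List.append_cancel_left_eq]
  rw [List.take_succ_eq_append_getElem ht]
  simp

lemma cotFn_apply (f : List Bool → Bool) {T : ℕ} (x : List Bool) (t : Fin T) :
    cotFn f T x t = f ((appendStep f)^[t] x) := by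
  simp only [cotFn, eteFn, Function.iterate_succ_apply']
  simp [appendStep]

lemma iterate_appendStep_eq_tokenPrefix {f : List Bool → Bool} {T : ℕ} {x : List Bool}
    {z : Fin T → Bool}
    (h : ∀ t : Fin T, (appendStep f)^[t] x = tokenPrefix x z t →
      f (tokenPrefix x z t) = z t) :
    ∀ t : ℕ, t ≤ T → (appendStep f)^[t] x = tokenPrefix x z t := by
  intro t
  induction t with
  | zero => simp [tokenPrefix]
  | succ t ih =>
    intro ht
    have hit := ih (by omega)
    have hz := h ⟨t, ht⟩ hit
    have hs := tokenPrefix_succ x z ⟨t, ht⟩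
    simp only at hz hs
    rw [Function.iterate_succ_apply', hit, hs, appendStep, hz]

/-- A generator produces the chain of thought `z` exactly when it predicts each token of `z`
from the tokens before it. -/
lemma cotFn_eq_iff (f : List Bool → Bool) {T : ℕ} (x : List Bool) (z : Fin T → Bool) :
    cotFn f T x = z ↔ ∀ t : Fin T, f (tokenPrefix x z t) = z t := by
  constructor
  · intro h
    have h' : ∀ t : Fin T, f ((appendStep f)^[t] x) = z t := fun t => by
      rw [← cotFn_apply f x t, h]
    intro t
    have hpre := iterate_appendStep_eq_tokenPrefix (f := f) (z := z)
      (fun t ht => by rw [← ht, h']) t t.2.le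
    rw [← hpre, h']
  · intro h
    funext t
    rw [cotFn_apply, iterate_appendStep_eq_tokenPrefix (fun t _ => h t) t t.2.le, h]

open Classical in
/-- The traces of a class `F` on an indexed family of points. -/
noncomputable def traces {Z α : Type*} [Fintype α] (F : Set (Z → Bool)) (p : α → Z) :
    Finset (Finset α) :=
  Finset.univ.filter fun A => ∃ f ∈ F, A = Finset.univ.filter fun a => f (p a) = true

lemma mem_traces {Z α : Type*} [Fintype α] {F : Set (Z → Bool)} {p : α → Z}
    {f : Z → Bool} (hf : f ∈ F) :
    (Finset.univ.filter fun a => f (p a) = true) ∈ traces F p := by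
  classical
  simp only [traces, Finset.mem_filter, Finset.mem_univ, true_and]
  exact ⟨f, hf, rfl⟩

lemma shattersOn_of_shatters_traces {Z α : Type*} [Fintype α] [DecidableEq α]
    {F : Set (Z → Bool)} {p : α → Z} {s : Finset α} (hs : (traces F p).Shatters s) :
    ShattersOn F (fun i : Fin s.card => p (s.equivFin.symm i)) := by
  intro v
  obtain ⟨u, hu, hsu⟩ := hs
    (t := s.filter fun a => ∃ h : a ∈ s, v (s.equivFin ⟨a, h⟩) = true) (Finset.filter_subset _ _)
  simp only [traces, Finset.mem_filter, Finset.mem_univ, true_and] at hu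
  obtain ⟨f, hf, rfl⟩ := hu
  refine ⟨f, hf, fun i => ?_⟩
  have h := Finset.ext_iff.1 hsu (s.equivFin.symm i)
  simp only [Finset.mem_inter, Finset.mem_filter, Finset.coe_mem, Finset.mem_univ, true_and,
    Subtype.coe_eta, Equiv.apply_symm_apply, exists_true_left] at h
  exact Bool.eq_iff_iff.2 h

/-- The **Sauer-Shelah lemma** for classes of Boolean functions. -/
lemma card_traces_le {Z α : Type*} [Fintype α] {F : Set (Z → Bool)} {D : ℕ}
    (hF : ∀ (m : ℕ) (s : Fin m → Z), ShattersOn F s → m ≤ D) (p : α → Z) :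
    (traces F p).card ≤ ∑ k ∈ Finset.Iic D, (Fintype.card α).choose k := by
  classical
  have hvc : (traces F p).vcDim ≤ D := Finset.sup_le fun s hs =>
    hF _ _ (shattersOn_of_shatters_traces (Finset.mem_shatterer.1 hs))
  calc (traces F p).card ≤ (traces F p).shatterer.card := Finset.card_le_card_shatterer _
    _ ≤ ∑ k ∈ Finset.Iic (traces F p).vcDim, (Fintype.card α).choose k :=
      Finset.card_shatterer_le_sum_vcDim
    _ ≤ _ := Finset.sum_le_sum_of_subset (Finset.Iic_subset_Iic.2 hvc)

lemma sum_choose_le {N D : ℕ} (hD : 1 ≤ D) (hN : D ≤ N) :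
    (∑ k ∈ Finset.Iic D, (N.choose k : ℝ)) ≤ (Real.exp 1 * N / D) ^ D := by
  have hD0 : (0 : ℝ) < D := by exact_mod_cast hD
  have hDN : (D : ℝ) ≤ N := by exact_mod_cast hN
  have hN0 : (0 : ℝ) < N := hD0.trans_le hDN
  set r : ℝ := D / N with hr
  have hr0 : 0 < r := by positivity
  have hr1 : r ≤ 1 := (div_le_one hN0).2 hDN
  have hbin : (∑ k ∈ Finset.Iic D, (N.choose k : ℝ)) * r ^ D ≤ Real.exp 1 ^ D := by
    calc (∑ k ∈ Finset.Iic D, (N.choose k : ℝ)) * r ^ D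
        = ∑ k ∈ Finset.Iic D, (N.choose k : ℝ) * r ^ D := Finset.sum_mul _ _ _
      _ ≤ ∑ k ∈ Finset.Iic D, r ^ k * (N.choose k : ℝ) := by
          refine Finset.sum_le_sum fun k hk => ?_
          rw [mul_comm]
          exact mul_le_mul_of_nonneg_right
            (pow_le_pow_of_le_one hr0.le hr1 (Finset.mem_Iic.1 hk)) (by positivity)
      _ ≤ ∑ k ∈ Finset.range (N + 1), r ^ k * (N.choose k : ℝ) := by
          refine Finset.sum_le_sum_of_subset_of_nonneg (fun k hk => ?_)
            fun _ _ _ => by positivity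
          have := Finset.mem_Iic.1 hk
          exact Finset.mem_range.2 (by omega)
      _ = (r + 1) ^ N := by simp [add_pow]
      _ ≤ Real.exp r ^ N := by gcongr; exact Real.add_one_le_exp r
      _ = Real.exp 1 ^ D := by
          rw [← Real.exp_nat_mul, ← Real.exp_nat_mul]
          congr 1
          rw [hr]
          field_simp
  calc (∑ k ∈ Finset.Iic D, (N.choose k : ℝ)) ≤ Real.exp 1 ^ D / r ^ D :=
        (le_div_iff₀ (by positivity)).2 hbin
    _ = (Real.exp 1 * N / D) ^ D := by
        rw [← div_pow, hr]
        congr 1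
        field_simp

/-- A tuple shattered by the loss class is no longer than the number of bits needed to
describe `κ` traces of `F` on the contexts of its points. -/
lemma two_pow_le_of_shattersOn_lossClass {F : Set (List Bool → Bool)} {T κ m : ℕ}
    {s : Fin m → List Bool × (Fin T → Bool)} (hs : ShattersOn (lossClass F T κ) s) :
    2 ^ m ≤ (traces F fun q : Fin m × Fin T =>
      tokenPrefix (s q.1).1 (s q.1).2 q.2).card ^ κ := by
  classical
  set p : Fin m × Fin T → List Bool := fun q => tokenPrefix (s q.1).1 (s q.1).2 q.2 with hp
  choose h hh hv using hs
  choose f hf _ hfh using hh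
  let φ : (Fin m → Bool) → (Fin κ → traces F p) := fun v j => ⟨_, mem_traces (hf v j)⟩
  have hφ : Function.Injective φ := by
    intro v w hvw
    have hfv : ∀ j q, f v j (p q) = f w j (p q) := by
      intro j q
      have := Finset.ext_iff.1 (congrArg Subtype.val (congrFun hvw j)) q
      simp only [φ, Finset.mem_filter, Finset.mem_univ, true_and] at this
      exact Bool.eq_iff_iff.2 this
    funext i
    rw [← hv v i, ← hv w i, hfh v, hfh w]
    simp only [ne_eq, cotFn_eq_iff, decide_eq_decide]
    refine forall_congr' fun j => not_congr (forall_congr' fun t => ?_)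
    have := hfv j (i, t)
    simp only [hp] at this
    rw [this]
  simpa using Fintype.card_le_of_injective φ hφ

/-- Tangent-line bound that solves `u ≤ log₂ (e a u)` for `u`. -/
lemma le_two_mul_logb_of_le_logb {u a : ℝ} (hu : 0 < u) (ha : 0 < a)
    (h : u ≤ Real.logb 2 (Real.exp 1 * a * u)) :
    u ≤ 2 * Real.logb 2 (2 * a / Real.log 2) := by
  have hl : 0 < Real.log 2 := Real.log_pos (by norm_num)
  have ht := Real.log_le_sub_one_of_pos (show 0 < u * (Real.log 2 / 2) by positivity)
  rw [Real.log_mul (by positivity) (by positivity), Real.log_div (by positivity) (by positivity)]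
    at ht
  rw [Real.logb, le_div_iff₀ hl, Real.log_mul (by positivity) (by positivity),
    Real.log_mul (by positivity) (by positivity), Real.log_exp] at h
  rw [Real.logb, ← mul_div_assoc, le_div_iff₀ hl, Real.log_div (by positivity) (by positivity),
    Real.log_mul (by positivity) (by positivity)]
  linarith

/-- **VC-dimension bound for the κ-thinker CoT loss class.**  If `F` has VC dimension
exactly `D ≥ 1` (every shattered tuple has size ≤ `D`, and some tuple of size `D` is
shattered), then `VCdim(L_T^CoT(F;κ)) ≤ 3·κ·D·log₂(2κT/ln 2)`, i.e. every tuple shattered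
by the loss class has size at most that bound. -/
theorem stmt8 (F : Set (List Bool → Bool)) (T κ D : ℕ)
    (hT : 1 ≤ T) (hκ : 1 ≤ κ) (hD : 1 ≤ D)
    (hVCub : ∀ (m : ℕ) (s : Fin m → List Bool), ShattersOn F s → m ≤ D)
    (hVClb : ∃ s : Fin D → List Bool, ShattersOn F s) :
    ∀ (m : ℕ) (s : Fin m → List Bool × (Fin T → Bool)),
      ShattersOn (lossClass F T κ) s →
      (m : ℝ) ≤ 3 * κ * D * Real.logb 2 (2 * κ * T / Real.log 2) := by
  intro m s hs
  have hT0 : (1 : ℝ) ≤ T := by exact_mod_cast hT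
  have hκ0 : (1 : ℝ) ≤ κ := by exact_mod_cast hκ
  have hD0 : (1 : ℝ) ≤ D := by exact_mod_cast hD
  have hκT : (1 : ℝ) ≤ κ * T := one_le_mul_of_one_le_of_one_le hκ0 hT0
  have hκD : (1 : ℝ) ≤ κ * D := one_le_mul_of_one_le_of_one_le hκ0 hD0
  have hl : 0 < Real.log 2 := Real.log_pos (by norm_num)
  have hL : 1 ≤ Real.logb 2 (2 * κ * T / Real.log 2) := by
    rw [Real.le_logb_iff_rpow_le (by norm_num) (by positivity), Real.rpow_one, le_div_iff₀ hl]
    nlinarith [Real.log_two_lt_d9]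
  rcases le_or_gt m D with hm | hm
  · have hm' : (m : ℝ) ≤ D := by exact_mod_cast hm
    have h1 : (D : ℝ) ≤ κ * D := le_mul_of_one_le_left (by positivity) hκ0
    nlinarith
  have hm0 : (0 : ℝ) < m := by exact_mod_cast (by omega : 0 < m)
  have hN : D ≤ m * T := hm.le.trans (Nat.le_mul_of_pos_right m hT)
  have hcount : (2 : ℝ) ^ m ≤ (Real.exp 1 * (κ * T) * (m / (κ * D))) ^ (κ * D) := by
    calc (2 : ℝ) ^ m ≤ ((traces F fun q : Fin m × Fin T =>
          tokenPrefix (s q.1).1 (s q.1).2 q.2).card : ℝ) ^ κ := by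
          exact_mod_cast two_pow_le_of_shattersOn_lossClass hs
      _ ≤ ((Real.exp 1 * (m * T : ℕ) / D) ^ D) ^ κ := by
          gcongr
          refine le_trans ?_ (sum_choose_le hD hN)
          exact_mod_cast (card_traces_le hVCub _).trans_eq (by simp)
      _ = _ := by
          rw [← pow_mul, mul_comm D κ]
          congr 1
          push_cast
          field_simp
  have hlog := Real.logb_le_logb_of_le (b := 2) (by norm_num) (by positivity) hcount
  rw [Real.logb_pow, Real.logb_pow, Real.logb_self_eq_one (by norm_num), mul_one] at hlog
  push_cast at hlog
  have hu := le_two_mul_logb_of_le_logb (u := m / (κ * D)) (a := κ * T) (by positivity)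
    (by positivity) ((div_le_iff₀' (by positivity)).2 hlog)
  rw [div_le_iff₀ (by positivity), ← mul_assoc 2 (κ : ℝ) (T : ℝ)] at hu
  nlinarith

end CoTPaper
end

section
/- Let D and D_shift be probability distributions on X × {0,1} with identical class-conditional distributions, i.e., D(· | Y = y) = D_shift(· | Y = y) for y ∈ {0,1}. Suppose Pr_{(x,y)∼D}[y = 0] ∈ [1/2 − b₁, 1/2 + b₁] and Pr_{(x,y)∼D_shift}[y = 0] ∈ [1/2 + b₂, 1/2 + b₃] for constants 0 < b₁ < b₂ < b₃ < 1/2. Let h : X → {0,1} satisfy ℓ_{D_shift}(h) ≤ (1/2)·Pr_{(x,y)∼D_shift}[y = 1], where ℓ_P(h) := Pr_{(x,y)∼P}[h(x) ≠ y]. Then ℓ_D(h) ≤ 1/4 + b₁/2. -/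
open MeasureTheory ProbabilityTheory

/-- Law of total probability over the Boolean label. -/
theorem measureReal_eq_cond_label {X : Type*} [MeasurableSpace X]
    (P : Measure (X × Bool)) [IsProbabilityMeasure P] (E : Set (X × Bool)) :
    P.real E
      = P.real {p | p.2 = false} * (ProbabilityTheory.cond P {p | p.2 = false}).real E
        + P.real {p | p.2 = true} * (ProbabilityTheory.cond P {p | p.2 = true}).real E := by
  have hS (y : Bool) : MeasurableSet {p : X × Bool | p.2 = y} :=
    measurable_snd (measurableSet_singleton y)
  have hmul (y : Bool) : P.real {p | p.2 = y} *
      (ProbabilityTheory.cond P {p | p.2 = y}).real E = P.real (E ∩ {p | p.2 = y}) := by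
    rw [Set.inter_comm, measureReal_def, measureReal_def, measureReal_def,
      ← ENNReal.toReal_mul, mul_comm, cond_mul_eq_inter (hS y)]
  have hsdiff : E \ {p | p.2 = false} = E ∩ {p | p.2 = true} := by
    ext p
    simp
  rw [hmul, hmul, ← hsdiff, measureReal_inter_add_sdiff (hS false)]

/-- The two labels have total probability one. -/
theorem measureReal_label_true {X : Type*} [MeasurableSpace X]
    (P : Measure (X × Bool)) [IsProbabilityMeasure P] :
    P.real {p | p.2 = true} = 1 - P.real {p | p.2 = false} := by
  have hS : MeasurableSet {p : X × Bool | p.2 = false} :=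
    measurable_snd (measurableSet_singleton false)
  rw [← probReal_compl_eq_one_sub hS]
  congr 1
  ext p
  simp

/-- **Error transfer under class-prior shift.**  Let `D` and `Dsh` be probability
distributions on `X × {0,1}` (labels modeled by `Bool`, with `0 = false`, `1 = true`)
with identical class-conditional distributions.  Suppose `Pr_D[y = 0] ∈ [½−b₁, ½+b₁]`
and `Pr_{Dsh}[y = 0] ∈ [½+b₂, ½+b₃]` with `0 < b₁ < b₂ < b₃ < ½`.  If a classifier
`h : X → {0,1}` satisfies `ℓ_{Dsh}(h) ≤ ½·Pr_{Dsh}[y = 1]`, then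
`ℓ_D(h) ≤ 1/4 + b₁/2`. -/
theorem stmt10 {X : Type*} [MeasurableSpace X]
    (D Dsh : Measure (X × Bool)) [IsProbabilityMeasure D] [IsProbabilityMeasure Dsh]
    (b1 b2 b3 : ℝ)
    (hb1 : 0 < b1) (hb12 : b1 < b2) (hb23 : b2 < b3) (hb3 : b3 < 1 / 2)
    (hcond : ∀ y : Bool,
      ProbabilityTheory.cond D {p : X × Bool | p.2 = y}
        = ProbabilityTheory.cond Dsh {p : X × Bool | p.2 = y})
    (hD0 : (D {p : X × Bool | p.2 = false}).toReal ∈ Set.Icc (1 / 2 - b1) (1 / 2 + b1))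
    (hDsh0 : (Dsh {p : X × Bool | p.2 = false}).toReal ∈ Set.Icc (1 / 2 + b2) (1 / 2 + b3))
    (h : X → Bool) (hmeas : Measurable h)
    (hrisk : (Dsh {p : X × Bool | h p.1 ≠ p.2}).toReal
        ≤ (1 / 2) * (Dsh {p : X × Bool | p.2 = true}).toReal) :
    (D {p : X × Bool | h p.1 ≠ p.2}).toReal ≤ 1 / 4 + b1 / 2 := by
  simp only [← measureReal_def] at hD0 hDsh0 hrisk ⊢
  have hsplit := measureReal_eq_cond_label D {p : X × Bool | h p.1 ≠ p.2}
  rw [measureReal_eq_cond_label Dsh, ← hcond false, ← hcond true,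
    measureReal_label_true Dsh] at hrisk
  rw [measureReal_label_true D] at hsplit
  rw [hsplit]
  obtain ⟨hp, hp'⟩ := hD0
  obtain ⟨hq, hq'⟩ := hDsh0
  have he : 0 ≤ (ProbabilityTheory.cond D {p | p.2 = false}).real
      {p : X × Bool | h p.1 ≠ p.2} := measureReal_nonneg
  generalize D.real {p | p.2 = false} = p at *
  generalize Dsh.real {p | p.2 = false} = q at *
  generalize (ProbabilityTheory.cond D {p | p.2 = false}).real _ = e₀ at *
  generalize (ProbabilityTheory.cond D {p | p.2 = true}).real _ = e₁ at *
  have hscaled : (1 - q) * (p * e₀ + (1 - p) * e₁) ≤ (1 - q) * ((1 - p) / 2) := by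
    have h₁ := mul_le_mul_of_nonneg_left hrisk (by linarith : 0 ≤ 1 - p)
    have h₂ := mul_nonneg (by linarith : 0 ≤ q - p) he
    linarith
  have hbound := le_of_mul_le_mul_left hscaled (by linarith)
  linarith
end

section
/- There is a universal constant C > 0 such that the following holds for every d ∈ ℕ, every k ≤ d, every S* ⊆ [d] with |S*| = k, every η ∈ [0, 1/2), and every δ ∈ (0,1). Let x^{(1)},…,x^{(m)} be i.i.d. uniform on {0,1}^d, and let ξ^{(i)}_t (for i ∈ [m], 0 ≤ t ≤ k) be i.i.d. Bernoulli(η) independent of the inputs. Let each bijection π^{(i)} : [k] → S* be chosen as an arbitrary (measurable) function of the whole input tuple (x^{(1)},…,x^{(m)}). Generate the noisy chains z̃^{(i)}_0 = ξ^{(i)}_0, z̃^{(i)}_t = z̃^{(i)}_{t−1} ⊕ x^{(i)}_{π^{(i)}(t)} ⊕ ξ^{(i)}_t for t = 1,…,k. Define δ̃^{(i)}_t = 1 − 2·(z̃^{(i)}_t ⊕ z̃^{(i)}_{t−1}), s̃^{(i)} = ∑_{t=1}^k δ̃^{(i)}_t, score(j) = (1/m)·∑_{i=1}^m (1 − 2x^{(i)}_j)·s̃^{(i)}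 for j ∈ [d], and let Ŝ be a set of k indices with the largest scores (any tie-breaking rule). If m ≥ C·(k/(1−2η)²)·log(d/δ), then Pr[Ŝ = S*] ≥ 1 − δ. -/
open scoped Classical

namespace CoTPaper

/-- The noisy chain: `z̃_0 = ξ_0` and `z̃_t = z̃_{t−1} ⊕ x_{π(t)} ⊕ ξ_t` for `t = 1,…,k`
(indices of `π` and `ξ` are zero-based, so step `t+1` uses `π ⟨t⟩` and `ξ ⟨t+1⟩`). -/
def ztilde {d k : ℕ} (x : Fin d → Bool) (π : Fin k → Fin d)
    (ξ : Fin (k + 1) → Bool) : ℕ → Bool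
  | 0 => ξ 0
  | t + 1 =>
      xor (xor (ztilde x π ξ t)
          (if h : t < k then x (π ⟨t, h⟩) else false))
        (if h : t + 1 < k + 1 then ξ ⟨t + 1, h⟩ else false)

/-- `s̃ = ∑_{t=1}^k δ̃_t` with `δ̃_t = 1 − 2·(z̃_t ⊕ z̃_{t−1})`. -/
noncomputable def stilde {d k : ℕ} (x : Fin d → Bool) (π : Fin k → Fin d)
    (ξ : Fin (k + 1) → Bool) : ℝ :=
  ∑ t ∈ Finset.range k,
    (1 - 2 * (if xor (ztilde x π ξ (t + 1)) (ztilde x π ξ t) then (1 : ℝ) else 0))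

/-- `score(j) = (1/m)·∑_i (1 − 2x^{(i)}_j)·s̃^{(i)}`. -/
noncomputable def score {d k m : ℕ} (X : Fin m → Fin d → Bool)
    (Ξ : Fin m → Fin (k + 1) → Bool) (τ : Fin m → Fin k → Fin d) (j : Fin d) : ℝ :=
  (1 / (m : ℝ)) *
    ∑ i, (1 - 2 * (if X i j then (1 : ℝ) else 0)) * stilde (X i) (τ i) (Ξ i)

/-- The sign `(-1)^b` of a bit. -/
def bitSign (b : Bool) : ℝ := 1 - 2 * (if b then (1 : ℝ) else 0)

/-- The moment generating function of the sign of a Bernoulli(η) bit. -/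
noncomputable def signMgf (η u : ℝ) : ℝ := (1 - η) * Real.exp u + η * Real.exp (-u)

lemma bitSign_mul_self (b : Bool) : bitSign b * bitSign b = 1 := by
  cases b <;> norm_num [bitSign]

lemma bitSign_xor (a b : Bool) : bitSign (xor a b) = bitSign a * bitSign b := by
  cases a <;> cases b <;> norm_num [bitSign]

lemma sum_bernoulli_mul_exp (η u : ℝ) :
    ∑ b : Bool, (if b then η else 1 - η) * Real.exp (u * bitSign b) = signMgf η u := by
  simp only [Fintype.sum_bool, bitSign, signMgf]
  norm_num
  ring

lemma signMgf_nonneg {η : ℝ} (h0 : 0 ≤ η) (h1 : η ≤ 1) (u : ℝ) : 0 ≤ signMgf η u := by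
  have : 0 ≤ 1 - η := by linarith
  unfold signMgf
  positivity

lemma sum_signMgf (η u : ℝ) :
    ∑ b : Bool, signMgf η (u * bitSign b) = 2 * Real.cosh u := by
  simp only [Fintype.sum_bool, bitSign, signMgf, Real.cosh_eq]
  norm_num
  ring

lemma sum_prod_eq_prod_sum {ι β R : Type*} [Fintype ι] [DecidableEq ι] [Fintype β]
    [CommSemiring R] (f : ι → β → R) :
    ∑ x : ι → β, ∏ i, f i (x i) = ∏ i, ∑ b, f i b := by
  rw [Finset.prod_univ_sum, Fintype.piFinset_univ]

lemma stilde_eq_sum {d k : ℕ} (x : Fin d → Bool) (π : Fin k → Fin d)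
    (ξ : Fin (k + 1) → Bool) :
    stilde x π ξ = ∑ t : Fin k, bitSign (x (π t)) * bitSign (ξ t.succ) := by
  unfold stilde
  rw [Finset.sum_range]
  refine Finset.sum_congr rfl fun t _ => ?_
  have h : xor (ztilde x π ξ (t + 1)) (ztilde x π ξ t) = xor (x (π t)) (ξ t.succ) := by
    have ht : (t : ℕ) + 1 < k + 1 := by omega
    simp only [ztilde, t.isLt, ht, dif_pos]
    change xor (xor (xor _ (x (π t))) (ξ t.succ)) _ = _
    generalize ztilde x π ξ t = a, x (π t) = b, ξ t.succ = c
    revert a b c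
    decide
  rw [h, ← bitSign_xor, bitSign]

lemma prod_comp_eq_prod_of_card {α M : Type*} [DecidableEq α] [CommMonoid M] {k : ℕ}
    {S : Finset α} (hS : S.card = k) {π : Fin k → α} (hinj : Function.Injective π)
    (hmem : ∀ t, π t ∈ S) (f : α → M) : ∏ t, f (π t) = ∏ l ∈ S, f l := by
  have h : Finset.univ.image π = S := by
    apply Finset.eq_of_subset_of_card_le
    · intro a ha
      obtain ⟨t, -, rfl⟩ := Finset.mem_image.1 ha
      exact hmem t
    · rw [Finset.card_image_of_injective _ hinj, Finset.card_univ, Fintype.card_fin, hS]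
  rw [← h, Finset.prod_image (fun a _ b _ hab => hinj hab)]

lemma sum_noise_exp_stilde {d k : ℕ} {S : Finset (Fin d)} (hS : S.card = k)
    {π : Fin k → Fin d} (hinj : Function.Injective π) (hmem : ∀ t, π t ∈ S)
    (x : Fin d → Bool) (η u : ℝ) :
    ∑ ξ : Fin (k + 1) → Bool, (∏ t, if ξ t then η else 1 - η) * Real.exp (u * stilde x π ξ)
      = ∏ l ∈ S, signMgf η (u * bitSign (x l)) := by
  let g : Fin (k + 1) → Bool → ℝ := Fin.cons (fun b => if b then η else 1 - η)
    (fun t b => (if b then η else 1 - η) * Real.exp (u * bitSign (x (π t)) * bitSign b))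
  have hg : ∀ ξ : Fin (k + 1) → Bool,
      (∏ t, if ξ t then η else 1 - η) * Real.exp (u * stilde x π ξ) = ∏ t, g t (ξ t) := by
    intro ξ
    rw [stilde_eq_sum, Finset.mul_sum, Real.exp_sum, Fin.prod_univ_succ, Fin.prod_univ_succ,
      mul_assoc, ← Finset.prod_mul_distrib]
    simp only [g, Fin.cons_zero, Fin.cons_succ, mul_assoc]
  simp_rw [hg]
  rw [sum_prod_eq_prod_sum, Fin.prod_univ_succ]
  simp only [g, Fin.cons_zero, Fin.cons_succ, sum_bernoulli_mul_exp]
  rw [prod_comp_eq_prod_of_card hS hinj hmem (fun l => signMgf η (u * bitSign (x l)))]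
  simp

/-- Flip every coordinate other than `j` by the `j`-th one. -/
def flipBy {d : ℕ} (j : Fin d) (x : Fin d → Bool) : Fin d → Bool :=
  fun l => if l = j then x j else xor (x l) (x j)

lemma flipBy_involutive {d : ℕ} (j : Fin d) : Function.Involutive (flipBy j) := by
  intro x
  funext l
  by_cases h : l = j
  · simp [flipBy, h]
  · simp [flipBy, h]

lemma sum_inputs_prod_signMgf {d : ℕ} (S : Finset (Fin d)) (j : Fin d) (η u : ℝ) :
    (1 / 2 ^ d : ℝ) * ∑ x : Fin d → Bool, ∏ l ∈ S, signMgf η (u * bitSign (x j) * bitSign (x l))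
      = (if j ∈ S then signMgf η u else 1) * Real.cosh u ^ (S.erase j).card := by
  let g : Fin d → Bool → ℝ := fun l b =>
    if l ∈ S then (if l = j then signMgf η u else signMgf η (u * bitSign b)) else 1
  have hflip : ∑ x : Fin d → Bool, ∏ l ∈ S, signMgf η (u * bitSign (x j) * bitSign (x l))
      = ∑ x : Fin d → Bool, ∏ l, g l (x l) := by
    refine Fintype.sum_equiv (flipBy_involutive j).toPerm _ _ fun x => ?_
    rw [← Finset.prod_subset (Finset.subset_univ S) (fun l _ hl => by simp [g, hl])]
    refine Finset.prod_congr rfl fun l hl => ?_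
    by_cases h : l = j
    · subst h
      simp [g, hl, mul_assoc, bitSign_mul_self]
    · simp only [g, hl, h, if_true, if_false, Function.Involutive.coe_toPerm, flipBy, bitSign_xor]
      congr 1
      ring
  have hhalf : (1 / 2 ^ d : ℝ) = ∏ _l : Fin d, (1 / 2 : ℝ) := by simp
  rw [hflip, sum_prod_eq_prod_sum, hhalf, ← Finset.prod_mul_distrib]
  have hl : ∀ l, (1 / 2 : ℝ) * ∑ b, g l b =
      if l ∈ S then (if l = j then signMgf η u else Real.cosh u) else 1 := by
    intro l
    by_cases h : l ∈ S
    · by_cases h' : l = j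
      · simp [g, h']
      · simp only [g, h, h', if_true, if_false, sum_signMgf]
        ring
    · simp [g, h]
  simp_rw [hl]
  rw [Finset.prod_ite_mem, Finset.univ_inter]
  have herase : ∏ l ∈ S.erase j, (if l = j then signMgf η u else Real.cosh u)
      = Real.cosh u ^ (S.erase j).card :=
    Finset.prod_eq_pow_card fun l hl => if_neg (Finset.ne_of_mem_erase hl)
  by_cases h : j ∈ S
  · rw [← Finset.mul_prod_erase S _ h, herase]
    simp [h]
  · rw [if_neg h, one_mul, ← herase, Finset.erase_eq_of_notMem h]

/-- The moment generating function of `m · score(j)` does not depend on the orderings. -/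
lemma mgf_score {d k m : ℕ} {S : Finset (Fin d)} (hS : S.card = k) (η u : ℝ)
    (π : (Fin m → Fin d → Bool) → Fin m → Fin k → Fin d)
    (hπ : ∀ X i, Function.Injective (π X i) ∧ ∀ t, π X i t ∈ S) (j : Fin d) :
    ∑ X : Fin m → Fin d → Bool, ∑ Ξ : Fin m → Fin (k + 1) → Bool,
        ((1 : ℝ) / 2 ^ (m * d)) * (∏ i, ∏ t, if Ξ i t then η else 1 - η) *
          Real.exp (u * ∑ i, bitSign (X i j) * stilde (X i) (π X i) (Ξ i))
      = ((if j ∈ S then signMgf η u else 1) * Real.cosh u ^ (S.erase j).card) ^ m := by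
  have hX : ∀ X : Fin m → Fin d → Bool, ∑ Ξ : Fin m → Fin (k + 1) → Bool,
        ((1 : ℝ) / 2 ^ (m * d)) * (∏ i, ∏ t, if Ξ i t then η else 1 - η) *
          Real.exp (u * ∑ i, bitSign (X i j) * stilde (X i) (π X i) (Ξ i))
      = ∏ i, ((1 / 2 ^ d : ℝ) *
          ∏ l ∈ S, signMgf η (u * bitSign (X i j) * bitSign (X i l))) := by
    intro X
    have hw : (1 : ℝ) / 2 ^ (m * d) = ∏ _i : Fin m, (1 / 2 ^ d : ℝ) := by
      rw [Finset.prod_const, Finset.card_univ, Fintype.card_fin, div_pow, one_pow, ← pow_mul,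
        mul_comm]
    rw [Finset.prod_mul_distrib, ← hw]
    simp_rw [mul_assoc ((1 : ℝ) / 2 ^ (m * d))]
    rw [← Finset.mul_sum]
    congr 1
    simp_rw [Finset.mul_sum, Real.exp_sum, ← Finset.prod_mul_distrib]
    rw [sum_prod_eq_prod_sum (fun i (ξ : Fin (k + 1) → Bool) =>
      (∏ t, if ξ t then η else 1 - η) *
        Real.exp (u * (bitSign (X i j) * stilde (X i) (π X i) ξ)))]
    refine Finset.prod_congr rfl fun i _ => ?_
    rw [← sum_noise_exp_stilde hS (hπ X i).1 (hπ X i).2]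
    simp_rw [mul_assoc]
  simp_rw [hX]
  rw [sum_prod_eq_prod_sum (fun (_ : Fin m) (x : Fin d → Bool) => (1 / 2 ^ d : ℝ) *
    ∏ l ∈ S, signMgf η (u * bitSign (x j) * bitSign (x l))), Finset.prod_const,
    Finset.card_univ, Fintype.card_fin, ← Finset.mul_sum, sum_inputs_prod_signMgf]

lemma signMgf_neg_le {η l : ℝ} (h1 : η ≤ 1 / 2) (hl0 : 0 ≤ l) (hl : l ≤ 1 / 4) :
    signMgf η (-l) ≤ Real.exp (l ^ 2 / 2 - 7 / 8 * ((1 - 2 * η) * l)) := by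
  have hrw : signMgf η (-l) = Real.cosh l - (1 - 2 * η) * Real.sinh l := by
    rw [signMgf, Real.cosh_eq, Real.sinh_eq, neg_neg]
    ring
  have hb : 0 ≤ (1 - 2 * η) * l := mul_nonneg (by linarith) hl0
  have hsinh : (1 - 2 * η) * l ≤ (1 - 2 * η) * Real.sinh l :=
    mul_le_mul_of_nonneg_left (Real.self_le_sinh_iff.2 hl0) (by linarith)
  have ha : 7 / 8 * Real.exp (l ^ 2 / 2) ≤ 1 := by
    have hneg : 7 / 8 ≤ Real.exp (-(l ^ 2 / 2)) := by
      have := Real.add_one_le_exp (-(l ^ 2 / 2))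
      nlinarith
    calc 7 / 8 * Real.exp (l ^ 2 / 2)
        ≤ Real.exp (-(l ^ 2 / 2)) * Real.exp (l ^ 2 / 2) := by gcongr
      _ = 1 := by rw [← Real.exp_add]; simp
  have hone := Real.add_one_le_exp (-(7 / 8 * ((1 - 2 * η) * l)))
  have hpos := Real.exp_pos (l ^ 2 / 2)
  rw [hrw, sub_eq_add_neg (l ^ 2 / 2), Real.exp_add]
  have := mul_le_mul_of_nonneg_left hone hpos.le
  have := Real.cosh_le_exp_half_sq l
  nlinarith

lemma cosh_pow_le_exp (u : ℝ) (n : ℕ) : Real.cosh u ^ n ≤ Real.exp (n * (u ^ 2 / 2)) := by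
  rw [Real.exp_nat_mul]
  exact pow_le_pow_left₀ (Real.cosh_pos u).le (Real.cosh_le_exp_half_sq u) n

/-- One-sample Chernoff factor for the event that index `j` is on the wrong side of the
threshold `(1 - 2η) / 2`. -/
lemma chernoff_factor_le {d k : ℕ} {S : Finset (Fin d)} (hS : S.card = k) (hk : 0 < k)
    {η : ℝ} (h0 : 0 ≤ η) (h1 : η < 1 / 2) (j : Fin d) {u : ℝ}
    (hu : u = (if j ∈ S then -1 else 1) * ((1 - 2 * η) / (4 * k))) :
    Real.exp (-(u * ((1 - 2 * η) / 2))) *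
        ((if j ∈ S then signMgf η u else 1) * Real.cosh u ^ (S.erase j).card)
      ≤ Real.exp (-((1 - 2 * η) ^ 2 / (16 * k))) := by
  have hkR : (1 : ℝ) ≤ k := by exact_mod_cast hk
  have hk0 : (k : ℝ) ≠ 0 := by positivity
  set l := (1 - 2 * η) / (4 * k) with hl
  have hl0 : 0 ≤ l := div_nonneg (by linarith) (by positivity)
  have hl1 : l ≤ 1 / 4 := by
    rw [hl, div_le_iff₀ (by positivity)]
    linarith
  have hrho : 1 - 2 * η = 4 * k * l := by
    rw [hl]
    field_simp
  have hrhs : (1 - 2 * η) ^ 2 / (16 * k) = k * l ^ 2 := by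
    rw [hrho]
    field_simp
    ring
  have hcosh := cosh_pow_le_exp u (S.erase j).card
  rw [hrhs]
  by_cases h : j ∈ S
  · have hcard : ((S.erase j).card : ℝ) = k - 1 := by
      rw [Finset.card_erase_of_mem h, hS, Nat.cast_pred hk]
    simp only [h, if_true] at hu ⊢
    have hu' : u = -l := by linarith
    have hM := signMgf_neg_le h1.le hl0 hl1
    rw [hcard] at hcosh
    rw [hu'] at hcosh ⊢
    calc _ ≤ Real.exp (-(-l * ((1 - 2 * η) / 2))) *
          (Real.exp (l ^ 2 / 2 - 7 / 8 * ((1 - 2 * η) * l)) *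
            Real.exp ((k - 1) * ((-l) ^ 2 / 2))) := by
          gcongr
      _ ≤ _ := by
          rw [← Real.exp_add, ← Real.exp_add, Real.exp_le_exp, hrho]
          nlinarith [sq_nonneg l]
  · have hcard : ((S.erase j).card : ℝ) = k := by
      rw [Finset.erase_eq_of_notMem h, hS]
    simp only [h, if_false, one_mul] at hu ⊢
    rw [hcard] at hcosh
    rw [hu] at hcosh ⊢
    calc _ ≤ Real.exp (-(l * ((1 - 2 * η) / 2))) * Real.exp (k * (l ^ 2 / 2)) := by gcongr
      _ ≤ _ := by
          rw [← Real.exp_add, Real.exp_le_exp, hrho]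
          nlinarith [mul_nonneg (zero_le_one.trans hkR) (sq_nonneg l)]

/-- If a top-`k` selection misses `S`, some index is on the wrong side of any threshold `θ`. -/
lemma exists_wrong_side {α : Type*} [DecidableEq α] {S T : Finset α} (hcard : T.card = S.card)
    {f : α → ℝ} (htop : ∀ j ∈ T, ∀ j' ∉ T, f j' ≤ f j) (hne : T ≠ S) (θ : ℝ) :
    ∃ j, 0 ≤ (if j ∈ S then -1 else 1) * (f j - θ) := by
  have hST : ¬ S ⊆ T := fun h => hne (Finset.eq_of_subset_of_card_le h hcard.le).symm
  have hTS : ¬ T ⊆ S := fun h => hne (Finset.eq_of_subset_of_card_le h hcard.ge)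
  obtain ⟨a, haS, haT⟩ := Finset.not_subset.1 hST
  obtain ⟨b, hbT, hbS⟩ := Finset.not_subset.1 hTS
  have hab := htop b hbT a haT
  by_cases h : f a ≤ θ
  · exact ⟨a, by simp only [haS, if_true]; linarith⟩
  · exact ⟨b, by simp only [hbS, if_false]; linarith⟩

lemma score_mul {d k m : ℕ} (X : Fin m → Fin d → Bool) (Ξ : Fin m → Fin (k + 1) → Bool)
    (τ : Fin m → Fin k → Fin d) (j : Fin d) :
    (m : ℝ) * score X Ξ τ j = ∑ i, bitSign (X i j) * stilde (X i) (τ i) (Ξ i) := by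
  unfold score bitSign
  rcases Nat.eq_zero_or_pos m with rfl | hm
  · simp
  · have : (m : ℝ) ≠ 0 := by positivity
    rw [← mul_assoc, mul_one_div_cancel this, one_mul]

/-- Total mass of the sample space. -/
lemma sum_weight (d k m : ℕ) (η : ℝ) :
    ∑ _X : Fin m → Fin d → Bool, ∑ Ξ : Fin m → Fin (k + 1) → Bool,
        ((1 : ℝ) / 2 ^ (m * d)) * (∏ i, ∏ t, if Ξ i t then η else 1 - η) = 1 := by
  have hnoise : ∑ Ξ : Fin m → Fin (k + 1) → Bool, (∏ i, ∏ t, if Ξ i t then η else 1 - η) = 1 := by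
    rw [sum_prod_eq_prod_sum (fun (_ : Fin m) (ξ : Fin (k + 1) → Bool) =>
      ∏ t, if ξ t then η else 1 - η)]
    refine Finset.prod_eq_one fun i _ => ?_
    rw [sum_prod_eq_prod_sum (fun (_ : Fin (k + 1)) (b : Bool) => if b then η else 1 - η)]
    simp
  simp_rw [← Finset.mul_sum]
  rw [hnoise]
  simp [← pow_mul, mul_comm]

/-- **Support recovery under propagating generation noise, with adversarially chosen
thinkers.**  There is a universal constant `C > 0` such that for every `d`, `k ≤ d`,
hidden support `S* ⊆ [d]` with `|S*| = k`, noise level `η ∈ [0,½)`, and `δ ∈ (0,1)`: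
with inputs `x^{(1)},…,x^{(m)}` i.i.d. uniform on `{0,1}^d` and noise bits `ξ^{(i)}_t`
i.i.d. Bernoulli(η) (probabilities written as a weighted sum over the finite sample
space), orderings `π^{(i)} : [k] → S*` chosen as arbitrary functions of the whole input
tuple, and `Ŝ` any selection of `k` indices with the largest scores, if
`m ≥ C·(k/(1−2η)²)·log(d/δ)` then `Pr[Ŝ = S*] ≥ 1 − δ`. -/
theorem stmt13 :
    ∃ C : ℝ, 0 < C ∧
      ∀ (d k m : ℕ), k ≤ d →
      ∀ (Sstar : Finset (Fin d)), Sstar.card = k →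
      ∀ (η : ℝ), 0 ≤ η → η < 1 / 2 →
      ∀ (δ : ℝ), δ ∈ Set.Ioo (0 : ℝ) 1 →
      ∀ (π : (Fin m → Fin d → Bool) → Fin m → Fin k → Fin d),
        (∀ X i, Function.Injective (π X i) ∧ ∀ t, π X i t ∈ Sstar) →
      ∀ (Shat : (Fin m → Fin d → Bool) → (Fin m → Fin (k + 1) → Bool) → Finset (Fin d)),
        (∀ X Ξ, (Shat X Ξ).card = k ∧
          ∀ j ∈ Shat X Ξ, ∀ j' ∉ Shat X Ξ, score X Ξ (π X) j' ≤ score X Ξ (π X) j) →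
      C * ((k : ℝ) / (1 - 2 * η) ^ 2) * Real.log ((d : ℝ) / δ) ≤ (m : ℝ) →
      1 - δ ≤
        ∑ X : Fin m → Fin d → Bool, ∑ Ξ : Fin m → Fin (k + 1) → Bool,
          ((1 : ℝ) / 2 ^ (m * d)) * (∏ i, ∏ t, if Ξ i t then η else 1 - η) *
            (if Shat X Ξ = Sstar then 1 else 0) := by
  refine ⟨32, by norm_num, ?_⟩
  intro d k m hkd S hS η h0 h1 δ ⟨hδ0, hδ1⟩ π hπ Shat hShat hm
  have hW : ∀ Ξ : Fin m → Fin (k + 1) → Bool,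
      0 ≤ ((1 : ℝ) / 2 ^ (m * d)) * (∏ i, ∏ t, if Ξ i t then η else 1 - η) := by
    intro Ξ
    refine mul_nonneg (by positivity)
      (Finset.prod_nonneg fun i _ => Finset.prod_nonneg fun t _ => ?_)
    split_ifs <;> linarith
  rcases Nat.eq_zero_or_pos k with rfl | hk
  · have hall : ∀ X Ξ, Shat X Ξ = S := fun X Ξ => by
      rw [Finset.card_eq_zero.1 hS, Finset.card_eq_zero.1 (hShat X Ξ).1]
    simp only [hall, if_true, mul_one]
    rw [sum_weight]
    linarith
  have hkR : (0 : ℝ) < k := by exact_mod_cast hk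
  have hd : (1 : ℝ) ≤ d := by exact_mod_cast hk.trans_le hkd
  have hρ : 0 < 1 - 2 * η := by linarith
  let u : Fin d → ℝ := fun j => (if j ∈ S then -1 else 1) * ((1 - 2 * η) / (4 * k))
  let bad : (Fin m → Fin d → Bool) → (Fin m → Fin (k + 1) → Bool) → Fin d → ℝ := fun X Ξ j =>
    Real.exp (-(u j * ((1 - 2 * η) / 2))) ^ m *
      Real.exp (u j * ∑ i, bitSign (X i j) * stilde (X i) (π X i) (Ξ i))
  have hind : ∀ X Ξ, 1 - ∑ j, bad X Ξ j ≤ if Shat X Ξ = S then (1 : ℝ) else 0 := by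
    intro X Ξ
    have hnn : ∀ j ∈ Finset.univ, 0 ≤ bad X Ξ j := fun j _ => by positivity
    split_ifs with h
    · linarith [Finset.sum_nonneg hnn]
    · obtain ⟨j, hj⟩ := exists_wrong_side ((hShat X Ξ).1.trans hS.symm) (hShat X Ξ).2 h
        ((1 - 2 * η) / 2)
      have hone : 1 ≤ bad X Ξ j := by
        simp only [bad]
        rw [← score_mul, ← Real.exp_nat_mul, ← Real.exp_add, Real.one_le_exp_iff]
        have : 0 ≤ (m : ℝ) * ((1 - 2 * η) / (4 * k)) := by positivity
        refine (mul_nonneg this hj).trans_eq ?_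
        simp only [u]
        ring
      linarith [Finset.single_le_sum hnn (Finset.mem_univ j)]
  have hbad : ∀ j, ∑ X : Fin m → Fin d → Bool, ∑ Ξ : Fin m → Fin (k + 1) → Bool,
      ((1 : ℝ) / 2 ^ (m * d)) * (∏ i, ∏ t, if Ξ i t then η else 1 - η) * bad X Ξ j
        ≤ (δ / d) ^ 2 := by
    intro j
    have hfac : 0 ≤ (if j ∈ S then signMgf η (u j) else 1) *
        Real.cosh (u j) ^ (S.erase j).card := by
      refine mul_nonneg ?_ (pow_nonneg (Real.cosh_pos _).le _)
      split_ifs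
      · exact signMgf_nonneg h0 (by linarith) _
      · exact zero_le_one
    simp only [bad, mul_left_comm _ (Real.exp (-(u j * ((1 - 2 * η) / 2))) ^ m)]
    simp_rw [← Finset.mul_sum]
    rw [mgf_score hS η (u j) π hπ j, ← mul_pow]
    refine (pow_le_pow_left₀ (mul_nonneg (Real.exp_pos _).le hfac)
      (chernoff_factor_le hS hk h0 h1 j rfl) m).trans ?_
    have hsq : (δ / d) ^ 2 = Real.exp (-(2 * Real.log (d / δ))) := by
      rw [← Real.exp_log (show 0 < δ / d by positivity), ← Real.exp_nat_mul, ← inv_div, Real.log_inv]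
      simp
    rw [hsq, ← Real.exp_nat_mul, Real.exp_le_exp]
    have hm' := mul_le_mul_of_nonneg_right hm
      (show 0 ≤ (1 - 2 * η) ^ 2 / (16 * k) by positivity)
    have : 32 * ((k : ℝ) / (1 - 2 * η) ^ 2) * Real.log (d / δ) * ((1 - 2 * η) ^ 2 / (16 * k))
        = 2 * Real.log (d / δ) := by
      field_simp
      ring
    linarith
  calc 1 - δ ≤ 1 - ∑ _j : Fin d, (δ / d) ^ 2 := by
        rw [Finset.sum_const, Finset.card_univ, Fintype.card_fin, nsmul_eq_mul]
        have : (d : ℝ) * (δ / d) ^ 2 = δ * (δ / d) := by field_simp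
        have hle : δ / d ≤ 1 := (div_le_one (by linarith)).2 (by linarith)
        nlinarith
    _ ≤ 1 - ∑ j, ∑ X : Fin m → Fin d → Bool, ∑ Ξ : Fin m → Fin (k + 1) → Bool,
          ((1 : ℝ) / 2 ^ (m * d)) * (∏ i, ∏ t, if Ξ i t then η else 1 - η) * bad X Ξ j := by
        gcongr with j
        exact hbad j
    _ = ∑ X : Fin m → Fin d → Bool, ∑ Ξ : Fin m → Fin (k + 1) → Bool,
          ((1 : ℝ) / 2 ^ (m * d)) * (∏ i, ∏ t, if Ξ i t then η else 1 - η) *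
            (1 - ∑ j, bad X Ξ j) := by
        simp_rw [mul_sub, mul_one, Finset.sum_sub_distrib, Finset.mul_sum]
        rw [sum_weight, Finset.sum_comm]
        congr 1
        exact Finset.sum_congr rfl fun X _ => Finset.sum_comm
    _ ≤ _ := by
        gcongr with X _ Ξ _
        · exact hW Ξ
        · exact hind X Ξ

end CoTPaper
end

section
/- Fix d ∈ ℕ and 1 ≤ k ≤ d − 1. Let S* be uniform over the k-element subsets of [d]. Conditionally on S*, let x^{(1)},…,x^{(m)} be i.i.d. uniform on {0,1}^d, let π^{(1)},…,π^{(m)} be i.i.d. uniform bijections from [k] to S* (independent of the inputs), and let z^{(i)}_t = x^{(i)}_{π^{(i)}(1)} ⊕ ⋯ ⊕ x^{(i)}_{π^{(i)}(t)} for t = 1,…,k. Then for every (possibly randomized) estimator Ŝ that is a function of the data (x^{(i)}, z^{(i)})_{i=1}^m (and independent auxiliary randomness), if Pr[Ŝ = S*] ≥ 1 − δ for some δ ∈ (0,1), then m ≥ ((1−δ)·log₂ C(d,k) − 1) / log₂(k+1), where C(d,k) is the binomial coefficient. -/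
open scoped Classical

namespace CoTPaper

/-- The noiseless chain of partial parities: the `t`-th entry (zero-based `t : Fin k`) is
`z_t = x_{π(1)} ⊕ ⋯ ⊕ x_{π(t)}`, i.e. the parity of the first `t+1` selected bits. -/
def partialParity {d k : ℕ} (x : Fin d → Bool) (τ : Fin k → Fin d) (t : Fin k) : Bool :=
  decide (Odd (Finset.univ.filter (fun s : Fin k => s ≤ t ∧ x (τ s) = true)).card)

/-- A permutation carrying one labelling of a finite type to another exists as soon as the two
labellings have fibers of equal size. -/
lemma exists_perm_comp_eq {α β : Type*} [Fintype α] (f g : α → β)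
    (h : ∀ c, (Finset.univ.filter (fun a => f a = c)).card =
      (Finset.univ.filter (fun a => g a = c)).card) :
    ∃ e : Equiv.Perm α, ∀ a, g (e a) = f a := by
  have h' : ∀ c, Nonempty ({a // f a = c} ≃ {a // g a = c}) := fun c => by
    rw [← Fintype.card_eq, Fintype.card_subtype, Fintype.card_subtype, h c]
  exact ⟨Equiv.ofFiberEquiv fun c => (h' c).some, fun a => Equiv.ofFiberEquiv_map _ a⟩

lemma exists_perm_mem_iff {α : Type*} [Fintype α] (x : α → Bool) {A B : Finset α}
    (hAB : A.card = B.card)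
    (hx : (A.filter (fun a => x a = true)).card = (B.filter (fun a => x a = true)).card) :
    ∃ e : Equiv.Perm α, (∀ a, e a ∈ B ↔ a ∈ A) ∧ ∀ a, x (e a) = x a := by
  have hx' : (A.filter (fun a => ¬ x a = true)).card =
      (B.filter (fun a => ¬ x a = true)).card := by
    have hA := A.card_filter_add_card_filter_not (fun a => x a = true)
    have hB := B.card_filter_add_card_filter_not (fun a => x a = true)
    omega
  have key (p : α → Prop) [DecidablePred p] (h : (A.filter p).card = (B.filter p).card) :
      (Aᶜ.filter p).card = (Bᶜ.filter p).card := by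
    have split (C : Finset α) :
        (C.filter p).card + (Cᶜ.filter p).card = (Finset.univ.filter p).card := by
      rw [← Finset.card_union_of_disjoint
        (Finset.disjoint_filter_filter disjoint_compl_right), ← Finset.filter_union,
        Finset.union_compl]
    have hA := split A
    have hB := split B
    omega
  have hc := key _ hx
  have hc' := key _ hx'
  obtain ⟨e, he⟩ := exists_perm_comp_eq (fun a => (decide (a ∈ A), x a))
    (fun a => (decide (a ∈ B), x a)) (by
      rintro ⟨_ | _, _ | _⟩
      · convert hc' using 2 <;> ext <;> simp
      · convert hc using 2 <;> ext <;> simp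
      · convert hx' using 2 <;> ext <;> simp
      · convert hx using 2 <;> ext <;> simp)
  refine ⟨e, fun a => ?_, fun a => (Prod.ext_iff.mp (he a)).2⟩
  simpa using (Prod.ext_iff.mp (he a)).1

/-- The tuples of `m` enumerations of `A` by `Fin k`, when `A` has `k` elements. -/
noncomputable def enumerations (m k : ℕ) {α : Type*} [Fintype α] (A : Finset α) :
    Finset (Fin m → Fin k → α) :=
  Finset.univ.filter fun τ => ∀ i, Function.Injective (τ i) ∧ ∀ t, τ i t ∈ A

lemma card_enumerations (m : ℕ) {k : ℕ} {α : Type*} [Fintype α] {A : Finset α}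
    (hA : A.card = k) : (enumerations m k A).card = k.factorial ^ m := by
  have hinj : (Finset.univ.filter fun f : Fin k → α =>
      Function.Injective f ∧ ∀ t, f t ∈ A).card = k.factorial := by
    rw [← Fintype.card_subtype]
    let e : {f : Fin k → α // Function.Injective f ∧ ∀ t, f t ∈ A} ≃ (Fin k ↪ A) :=
      { toFun := fun f => ⟨fun t => ⟨f.1 t, f.2.2 t⟩,
          fun s t h => f.2.1 (congrArg Subtype.val h)⟩
        invFun := fun g => ⟨fun t => g t, Subtype.val_injective.comp g.injective,
          fun t => (g t).2⟩
        left_inv := fun _ => rfl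
        right_inv := fun _ => rfl }
    rw [Fintype.card_congr e, Fintype.card_embedding_eq]
    simp [hA, Nat.descFactorial_self]
  have hpi : enumerations m k A = Fintype.piFinset fun _ : Fin m =>
      Finset.univ.filter fun f : Fin k → α => Function.Injective f ∧ ∀ t, f t ∈ A := by
    ext τ
    simp [enumerations]
  rw [hpi, Fintype.card_piFinset_const, hinj]

/-- The chains of partial parities have the same law under two supports that meet every input in
equally many ones. -/
lemma sum_enumerations_congr {d k m : ℕ} (X : Fin m → Fin d → Bool)
    (F : (Fin m → Fin k → Bool) → ℝ) {A B : Finset (Fin d)} (hAB : A.card = B.card)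
    (hX : ∀ i, (A.filter (fun a => X i a = true)).card =
      (B.filter (fun a => X i a = true)).card) :
    ∑ τ ∈ enumerations m k A, F (fun i => partialParity (X i) (τ i)) =
      ∑ τ ∈ enumerations m k B, F (fun i => partialParity (X i) (τ i)) := by
  choose e he hex using fun i => exists_perm_mem_iff (X i) hAB (hX i)
  refine Finset.sum_equiv
    (Equiv.piCongrRight fun i => (Equiv.refl (Fin k)).arrowCongr (e i)) ?_ ?_
  · intro τ
    have hcomp (i : Fin m) :
        Function.Injective (fun t => e i (τ i t)) ↔ Function.Injective (τ i) :=
      (e i).injective.of_comp_iff (τ i)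
    simp only [enumerations, Finset.mem_filter, Finset.mem_univ, true_and]
    refine forall_congr' fun i => and_congr (hcomp i).symm (forall_congr' fun t => ?_)
    exact (he i (τ i t)).symm
  · intro τ _
    congr 1
    funext i t
    simp [partialParity, Equiv.arrowCongr, hex]

/-- For fixed inputs, an estimator succeeds on at most `(k + 1) ^ m` supports in total, since it
only learns how many ones of each input lie in the support. -/
lemma sum_success_le {d k m : ℕ} (X : Fin m → Fin d → Bool)
    (Q : (Fin m → Fin k → Bool) → Finset (Fin d) → ℝ) (hQ0 : ∀ z A, 0 ≤ Q z A)
    (hQ1 : ∀ z, ∑ A, Q z A = 1) :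
    ∑ A ∈ Finset.univ.filter (fun A : Finset (Fin d) => A.card = k),
      ∑ τ ∈ enumerations m k A, Q (fun i => partialParity (X i) (τ i)) A ≤
      ((k : ℝ) + 1) ^ m * (k.factorial : ℝ) ^ m := by
  let W : Finset (Fin d) → Fin m → ℕ := fun A i => (A.filter (fun a => X i a = true)).card
  have hmaps : ∀ A ∈ Finset.univ.filter (fun A : Finset (Fin d) => A.card = k),
      W A ∈ Fintype.piFinset fun _ : Fin m => Finset.range (k + 1) := by
    intro A hA
    rw [Finset.mem_filter] at hA
    refine Fintype.mem_piFinset.mpr fun i => Finset.mem_range_succ_iff.mpr ?_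
    exact (Finset.card_filter_le _ _).trans hA.2.le
  rw [← Finset.sum_fiberwise_of_maps_to hmaps]
  calc _ ≤ ∑ _w ∈ Fintype.piFinset fun _ : Fin m => Finset.range (k + 1),
        (k.factorial : ℝ) ^ m := Finset.sum_le_sum fun w _ => ?_
    _ = _ := by simp
  set s := (Finset.univ.filter (fun A : Finset (Fin d) => A.card = k)).filter
    (fun A => W A = w) with hs
  obtain hempty | ⟨B, hB⟩ := s.eq_empty_or_nonempty
  · rw [hempty, Finset.sum_empty]
    positivity
  have mem_s {A : Finset (Fin d)} (hA : A ∈ s) : A.card = k ∧ W A = w := by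
    simpa [hs] using hA
  calc ∑ A ∈ s, ∑ τ ∈ enumerations m k A, Q (fun i => partialParity (X i) (τ i)) A
      = ∑ A ∈ s, ∑ τ ∈ enumerations m k B, Q (fun i => partialParity (X i) (τ i)) A := by
        refine Finset.sum_congr rfl fun A hA => ?_
        refine sum_enumerations_congr X (fun z => Q z A)
          ((mem_s hA).1.trans (mem_s hB).1.symm) fun i => ?_
        exact congrFun ((mem_s hA).2.trans (mem_s hB).2.symm) i
    _ ≤ ∑ A, ∑ τ ∈ enumerations m k B, Q (fun i => partialParity (X i) (τ i)) A :=
        Finset.sum_le_sum_of_subset_of_nonneg (Finset.subset_univ s)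
          fun A _ _ => Finset.sum_nonneg fun τ _ => hQ0 _ _
    _ = (k.factorial : ℝ) ^ m := by
        rw [Finset.sum_comm]
        simp [hQ1, card_enumerations m (mem_s hB).1]

lemma mul_sub_one_le_add_logb {p L : ℝ} (hp0 : 0 < p) (hp1 : p ≤ 1) (hpL : 1 ≤ p * L) :
    p * L - 1 ≤ L + Real.logb 2 p := by
  have hlog : -Real.logb 2 p ≤ p⁻¹ := by
    rw [← Real.logb_inv, Real.logb_le_iff_le_rpow (by norm_num) (inv_pos.mpr hp0)]
    have hB := one_add_mul_self_le_rpow_one_add (s := 1) (by norm_num) (one_le_inv₀ hp0 |>.mpr hp1)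
    norm_num at hB
    linarith
  have hL : p⁻¹ ≤ L := (inv_le_iff_one_le_mul₀' hp0).mpr hpL
  have hmul : (1 - p) * p⁻¹ ≤ (1 - p) * L :=
    mul_le_mul_of_nonneg_left hL (sub_nonneg.mpr hp1)
  rw [sub_mul, mul_inv_cancel₀ hp0.ne'] at hmul
  linarith

/-- **Information-theoretic lower bound from a random CoT generator (Fano).**
Fix `d` and `1 ≤ k ≤ d−1`.  Let `S*` be uniform over the `k`-subsets of `[d]`;
conditionally on `S*` let `x^{(1)},…,x^{(m)}` be i.i.d. uniform on `{0,1}^d` and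
`π^{(1)},…,π^{(m)}` i.i.d. uniform bijections from `[k]` to `S*`, and let `z^{(i)}` be the
noiseless partial-parity chain.  Any (possibly randomized) estimator — modeled as a
stochastic map `q` from data to a probability vector over candidate sets — with success
probability `Pr[Ŝ = S*] ≥ 1 − δ` (written as the explicit weighted sum over the finite
sample space) must satisfy `m ≥ ((1−δ)·log₂ C(d,k) − 1)/log₂(k+1)`. -/
theorem stmt16 (d k m : ℕ) (hk1 : 1 ≤ k) (hkd : k ≤ d - 1)
    (δ : ℝ) (hδ : δ ∈ Set.Ioo (0 : ℝ) 1)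
    (q : (Fin m → (Fin d → Bool) × (Fin k → Bool)) → Finset (Fin d) → ℝ)
    (hq0 : ∀ data A, 0 ≤ q data A)
    (hq1 : ∀ data, ∑ A : Finset (Fin d), q data A = 1)
    (hsucc : 1 - δ ≤
      ∑ A ∈ Finset.univ.filter (fun A : Finset (Fin d) => A.card = k),
        ((d.choose k : ℝ))⁻¹ *
          ∑ X : Fin m → Fin d → Bool,
            ((2 : ℝ) ^ (d * m))⁻¹ *
              ∑ τ ∈ Finset.univ.filter
                  (fun τ : Fin m → Fin k → Fin d =>
                    ∀ i, Function.Injective (τ i) ∧ ∀ t, τ i t ∈ A),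
                ((Nat.factorial k : ℝ) ^ m)⁻¹ *
                  q (fun i => (X i, partialParity (X i) (τ i))) A) :
    ((1 - δ) * Real.logb 2 (d.choose k) - 1) / Real.logb 2 (k + 1) ≤ (m : ℝ) := by
  obtain ⟨hδ0, hδ1⟩ := hδ
  have hC : (0 : ℝ) < d.choose k := by
    exact_mod_cast Nat.choose_pos (hkd.trans (Nat.sub_le d 1))
  have hk : (1 : ℝ) < k + 1 := by
    have : (1 : ℝ) ≤ k := by exact_mod_cast hk1
    linarith
  have hprob : 1 - δ ≤ ((k : ℝ) + 1) ^ m / d.choose k := by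
    refine hsucc.trans ?_
    have hX (X : Fin m → Fin d → Bool) := sum_success_le (k := k) X
      (fun z => q fun i => (X i, z i)) (fun _ => hq0 _) (fun _ => hq1 _)
    simp_rw [← Finset.mul_sum]
    rw [Finset.sum_comm]
    have hsum := Finset.sum_le_sum fun X (_ : X ∈ Finset.univ) => hX X
    rw [Finset.sum_const, Finset.card_univ, nsmul_eq_mul] at hsum
    have hcard : (Fintype.card (Fin m → Fin d → Bool) : ℝ) = 2 ^ (d * m) := by
      simp [pow_mul]
    rw [hcard] at hsum
    have hf : (0 : ℝ) < (k.factorial : ℝ) ^ m := by positivity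
    refine (mul_le_mul_of_nonneg_left (mul_le_mul_of_nonneg_left (mul_le_mul_of_nonneg_left
      (c := 2 ^ (d * m) * (((k : ℝ) + 1) ^ m * (k.factorial : ℝ) ^ m)) ?_
      (inv_nonneg.mpr hf.le)) (by positivity : (0 : ℝ) ≤ ((2 : ℝ) ^ (d * m))⁻¹))
      (inv_nonneg.mpr hC.le)).trans_eq ?_
    · simp only [enumerations] at hsum
      convert hsum
    have h2 : (2 : ℝ) ^ (d * m) ≠ 0 := by positivity
    have hf' := hf.ne'
    have hC' := hC.ne'
    generalize (2 : ℝ) ^ (d * m) = a at *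
    generalize (k.factorial : ℝ) ^ m = b at *
    field_simp
  have hlogk : 0 < Real.logb 2 ((k : ℝ) + 1) := Real.logb_pos (by norm_num) hk
  rw [div_le_iff₀ hlogk]
  rcases le_total ((1 - δ) * Real.logb 2 (d.choose k)) 1 with h | h
  · have : 0 ≤ (m : ℝ) * Real.logb 2 ((k : ℝ) + 1) := by positivity
    linarith
  have hp : 0 < 1 - δ := sub_pos.mpr hδ1
  have hlog := Real.logb_le_logb_of_le (b := 2) (by norm_num) hp hprob
  rw [Real.logb_div (by positivity) hC.ne', Real.logb_pow] at hlog
  have := mul_sub_one_le_add_logb hp (by linarith) h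
  linarith

end CoTPaper
end
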